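/- arXiv:1505.04924 — 10 statements merged into one kernel-verified Lean document; each statement's English description precedes it below -/
import Mathlib

section
/- For every β ∈ (0,1) there exists a finite constant C_β, depending only on β, such that for all κ > 0 and s > 0 one has ∫_ℝ [𝒩_β p_s(x)]² dx ≤ C_β (κ s)^{-1/2-β}. -/
open MeasureTheory Real

/-- The heat kernel on `ℝ` associated with the operator `(κ/2) ∂²/∂x²`. -/
noncomputable def heatKernel (κ t x : ℝ) : ℝ :=
  (2 * Real.pi * κ * t) ^ (-(1:ℝ)/2) * Real.exp (-x ^ 2 / (2 * κ * t))

/-- Change of variables `x = r * y` in a Lebesgue integral over `ℝ`. -/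
theorem lintegral_eq_ofReal_mul_lintegral_comp_mul_left (f : ℝ → ENNReal) {r : ℝ} (hr : 0 < r) :
    ∫⁻ x, f x = ENNReal.ofReal r * ∫⁻ x, f (r * x) := by
  have h := Real.smul_map_volume_mul_left hr.ne'
  rw [abs_of_pos hr] at h
  conv_lhs => rw [← h]
  rw [lintegral_smul_measure, (measurableEmbedding_mulLeft₀ hr.ne').lintegral_map, smul_eq_mul]

theorem heatKernel_sqrt_mul {κ s : ℝ} (hκ : 0 < κ) (hs : 0 < s) (x : ℝ) :
    heatKernel κ s (√(κ * s) * x) = (κ * s) ^ (-(1:ℝ)/2) * heatKernel 1 1 x := by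
  have ha : 0 < κ * s := mul_pos hκ hs
  have h1 : -(√(κ * s) * x) ^ 2 / (2 * κ * s) = -x ^ 2 / (2 * 1 * 1) := by
    rw [mul_pow, Real.sq_sqrt ha.le]
    field_simp
  have h2 : (2 * π * κ * s) ^ (-(1:ℝ)/2)
      = (κ * s) ^ (-(1:ℝ)/2) * (2 * π * 1 * 1) ^ (-(1:ℝ)/2) := by
    rw [← Real.mul_rpow ha.le (by positivity)]
    ring_nf
  rw [heatKernel, heatKernel, h1, h2, mul_assoc]

theorem heatKernel_one_one_sub_sq (x h : ℝ) :
    |heatKernel 1 1 (x + h) - heatKernel 1 1 x| ^ 2 = (2 * π)⁻¹ *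
      (exp (-1 * (x + h) ^ 2) + exp (-1 * x ^ 2)
        - 2 * exp (-(h ^ 2 / 4)) * exp (-1 * (x + h / 2) ^ 2)) := by
  have hc : ((2 * π) ^ (-(1:ℝ)/2)) ^ 2 = (2 * π)⁻¹ := by
    rw [← Real.rpow_natCast, ← Real.rpow_mul (by positivity), ← Real.rpow_neg_one]
    norm_num
  have e1 : exp (-1 * (x + h) ^ 2) = exp (-(x + h) ^ 2 / 2) ^ 2 := by
    rw [← Real.exp_nat_mul]; congr 1; push_cast; ring
  have e2 : exp (-1 * x ^ 2) = exp (-x ^ 2 / 2) ^ 2 := by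
    rw [← Real.exp_nat_mul]; congr 1; push_cast; ring
  have e3 : exp (-(h ^ 2 / 4)) * exp (-1 * (x + h / 2) ^ 2)
      = exp (-(x + h) ^ 2 / 2) * exp (-x ^ 2 / 2) := by
    rw [← Real.exp_add, ← Real.exp_add]; congr 1; ring
  rw [mul_assoc 2, e1, e2, e3, ← hc, sq_abs]
  simp only [heatKernel, mul_one]
  ring

theorem lintegral_heatKernel_one_one_sub_sq (h : ℝ) :
    ∫⁻ x, ENNReal.ofReal (|heatKernel 1 1 (x + h) - heatKernel 1 1 x| ^ 2)
      = ENNReal.ofReal ((√π / π) * (1 - exp (-(h ^ 2 / 4)))) := by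
  have hi := integrable_exp_neg_mul_sq (b := 1) one_pos
  have hi1 := hi.comp_add_right h
  have hi2 := (hi.comp_add_right (h / 2)).const_mul (2 * exp (-(h ^ 2 / 4)))
  have hval : ∫ x : ℝ, exp (-1 * x ^ 2) = √π := by
    rw [integral_gaussian, div_one]
  have hi3 : Integrable fun x : ℝ => exp (-1 * (x + h) ^ 2) + exp (-1 * x ^ 2) := hi1.add hi
  rw [← ofReal_integral_eq_lintegral_ofReal]
  · simp_rw [heatKernel_one_one_sub_sq]
    rw [integral_const_mul, integral_sub hi3 hi2, integral_add hi1 hi,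
      integral_const_mul, integral_add_right_eq_self (fun x : ℝ => exp (-1 * x ^ 2)),
      integral_add_right_eq_self (fun x : ℝ => exp (-1 * x ^ 2)), hval]
    congr 1
    field_simp
    ring
  · simp_rw [heatKernel_one_one_sub_sq]
    exact (hi3.sub hi2).const_mul _
  · exact ae_of_all _ fun x => by positivity

theorem integrable_of_even {f : ℝ → ℝ} (hf : ∀ x, f (-x) = f x)
    (hi : IntegrableOn f (Set.Ioi 0)) : Integrable f := by
  have hIic : IntegrableOn f (Set.Iic 0) := by
    have hm : MeasurableEmbedding fun x : ℝ => -x := (Homeomorph.neg ℝ).measurableEmbedding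
    rw [← Measure.map_neg_eq_self (volume : Measure ℝ), hm.integrableOn_map_iff]
    simpa [Function.comp_def, hf, integrableOn_Ici_iff_integrableOn_Ioi] using hi
  rw [← integrableOn_univ, ← Set.Iic_union_Ioi (a := (0:ℝ))]
  exact hIic.union hi

theorem integrable_min_one_sq_mul_abs_rpow {β : ℝ} (hβ : β ∈ Set.Ioo (0:ℝ) 1) :
    Integrable fun h : ℝ => min 1 (h ^ 2) * |h| ^ (-1 - 2 * β) := by
  obtain ⟨h0, h1⟩ := hβ
  suffices H : IntegrableOn (fun h : ℝ => min 1 (h ^ 2) * |h| ^ (-1 - 2 * β)) (Set.Ioi 0) by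
    exact integrable_of_even (fun h => by simp) H
  rw [← Set.Ioc_union_Ioi_eq_Ioi zero_le_one]
  refine IntegrableOn.union ?_ ?_
  · have := (intervalIntegral.intervalIntegrable_rpow' (a := 0) (b := 1)
      (r := 1 - 2 * β) (by linarith)).1
    refine this.congr_fun (fun h hh => ?_) measurableSet_Ioc
    simp only
    rw [min_eq_right (by nlinarith [hh.1, hh.2]), abs_of_pos hh.1, ← Real.rpow_natCast,
      ← Real.rpow_add hh.1]
    congr 1
    push_cast
    ring
  · refine (integrableOn_Ioi_rpow_of_lt (a := -1 - 2 * β) (by linarith) one_pos).congr_fun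
      (fun h hh => ?_) measurableSet_Ioi
    have hh' : (1:ℝ) < h := hh
    simp only
    rw [min_eq_left (by nlinarith), abs_of_pos (by linarith), one_mul]

theorem measurable_heatKernel (κ t : ℝ) : Measurable (heatKernel κ t) := by
  unfold heatKernel
  fun_prop

theorem lintegral_heatKernel_one_one_lt_top {β : ℝ} (hβ : β ∈ Set.Ioo (0:ℝ) 1) :
    (∫⁻ x : ℝ, ∫⁻ h : ℝ, ENNReal.ofReal
      (|heatKernel 1 1 (x + h) - heatKernel 1 1 x| ^ 2 * |h| ^ (-1 - 2 * β))) < ⊤ := by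
  have hm := measurable_heatKernel 1 1
  rw [lintegral_lintegral_swap (by
    have h1 := hm.comp (measurable_fst.add measurable_snd : Measurable fun z : ℝ × ℝ => z.1 + z.2)
    have h2 := hm.comp (measurable_fst : Measurable fun z : ℝ × ℝ => z.1)
    have h3 := h1.sub h2
    have h4 : Measurable fun z : ℝ × ℝ => |z.2| ^ (-1 - 2 * β) := by fun_prop
    exact (((continuous_abs.measurable.comp h3).pow_const 2).mul h4).ennreal_ofReal.aemeasurable)]
  refine lt_of_le_of_lt (lintegral_mono fun h => ?_)
    ((integrable_min_one_sq_mul_abs_rpow hβ).const_mul (√π / π)).lintegral_lt_top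
  have hmh : Measurable fun x =>
      ENNReal.ofReal (|heatKernel 1 1 (x + h) - heatKernel 1 1 x| ^ 2) :=
    ((continuous_abs.measurable.comp
      ((hm.comp (measurable_id.add_const h)).sub hm)).pow_const 2).ennreal_ofReal
  simp_rw [fun x => ENNReal.ofReal_mul (q := |h| ^ (-1 - 2 * β))
    (sq_nonneg |heatKernel 1 1 (x + h) - heatKernel 1 1 x|)]
  rw [lintegral_mul_const _ hmh, lintegral_heatKernel_one_one_sub_sq,
    ← ENNReal.ofReal_mul' (by positivity), ← mul_assoc]
  gcongr
  refine le_min ?_ ?_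
  · linarith [exp_pos (-(h ^ 2 / 4))]
  · linarith [add_one_le_exp (-(h ^ 2 / 4)), sq_nonneg h]

theorem lintegral_heatKernel_eq_mul {κ s : ℝ} (β : ℝ) (hκ : 0 < κ) (hs : 0 < s) :
    (∫⁻ x : ℝ, ∫⁻ h : ℝ, ENNReal.ofReal
      (|heatKernel κ s (x + h) - heatKernel κ s x| ^ 2 * |h| ^ (-1 - 2 * β)))
    = ENNReal.ofReal ((κ * s) ^ (-(1:ℝ)/2 - β)) * ∫⁻ x : ℝ, ∫⁻ h : ℝ, ENNReal.ofReal
      (|heatKernel 1 1 (x + h) - heatKernel 1 1 x| ^ 2 * |h| ^ (-1 - 2 * β)) := by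
  have ha : 0 < κ * s := mul_pos hκ hs
  have hr : 0 < √(κ * s) := Real.sqrt_pos.2 ha
  have hpt (x h : ℝ) : ENNReal.ofReal (|heatKernel κ s (√(κ * s) * x + √(κ * s) * h)
        - heatKernel κ s (√(κ * s) * x)| ^ 2 * |√(κ * s) * h| ^ (-1 - 2 * β))
      = ENNReal.ofReal ((κ * s) ^ (-(3:ℝ)/2 - β)) * ENNReal.ofReal
        (|heatKernel 1 1 (x + h) - heatKernel 1 1 x| ^ 2 * |h| ^ (-1 - 2 * β)) := by
    rw [← mul_add, heatKernel_sqrt_mul hκ hs, heatKernel_sqrt_mul hκ hs, ← mul_sub, abs_mul,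
      abs_mul, abs_of_pos hr, Real.mul_rpow hr.le (abs_nonneg h), mul_pow, sq_abs (_ ^ _),
      ← ENNReal.ofReal_mul (by positivity)]
    have hp : (κ * s) ^ (-(3:ℝ)/2 - β)
        = ((κ * s) ^ (-(1:ℝ)/2)) ^ 2 * √(κ * s) ^ (-1 - 2 * β) := by
      rw [Real.sqrt_eq_rpow, ← Real.rpow_natCast, ← Real.rpow_mul ha.le, ← Real.rpow_mul ha.le,
        ← Real.rpow_add ha]
      congr 1
      push_cast
      ring
    rw [hp]
    congr 1
    ring
  rw [lintegral_eq_ofReal_mul_lintegral_comp_mul_left _ hr]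
  simp_rw [fun x : ℝ => lintegral_eq_ofReal_mul_lintegral_comp_mul_left (fun h => ENNReal.ofReal
    (|heatKernel κ s (√(κ * s) * x + h) - heatKernel κ s (√(κ * s) * x)| ^ 2
      * |h| ^ (-1 - 2 * β))) hr, hpt]
  simp_rw [lintegral_const_mul' _ _ ENNReal.ofReal_ne_top, ← mul_assoc]
  rw [← ENNReal.ofReal_mul hr.le, Real.mul_self_sqrt ha.le, ← ENNReal.ofReal_mul ha.le]
  congr 2
  nth_rewrite 1 [← Real.rpow_one (κ * s)]
  rw [← Real.rpow_add ha]
  congr 1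
  ring


/-- For every `β ∈ (0,1)` there is a finite constant `C_β`, depending only on `β`, such that
for all `κ > 0` and `s > 0`,
`∫_ℝ [𝒩_β p_s(x)]² dx = ∫_ℝ ∫_ℝ |p_s(x+h) - p_s(x)|² |h|^{-1-2β} dh dx
  ≤ C_β (κ s)^{-1/2-β}`. -/
theorem stmt_0 (β : ℝ) (hβ : β ∈ Set.Ioo (0:ℝ) 1) :
    ∃ C : ℝ, 0 < C ∧ ∀ κ s : ℝ, 0 < κ → 0 < s →
      (∫⁻ x : ℝ, ∫⁻ h : ℝ, ENNReal.ofReal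
          (|heatKernel κ s (x + h) - heatKernel κ s x| ^ 2 * |h| ^ (-1 - 2 * β)))
        ≤ ENNReal.ofReal (C * (κ * s) ^ (-(1:ℝ)/2 - β)) := by
  set I : ENNReal := ∫⁻ x : ℝ, ∫⁻ h : ℝ, ENNReal.ofReal
    (|heatKernel 1 1 (x + h) - heatKernel 1 1 x| ^ 2 * |h| ^ (-1 - 2 * β)) with hI
  have hfin : I < ⊤ := lintegral_heatKernel_one_one_lt_top hβ
  refine ⟨I.toReal + 1, by positivity, fun κ s hκ hs => ?_⟩
  rw [lintegral_heatKernel_eq_mul β hκ hs, ← hI, mul_comm, ENNReal.ofReal_mul (by positivity)]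
  gcongr
  rw [ENNReal.le_ofReal_iff_toReal_le hfin.ne (by positivity)]
  linarith
end

section
/- Let β ∈ (0,1) and T > 0. The space X^β_T is complete in the following sense: if (f_n) is a sequence in X^β_T such that for every R > 0, sup_{t∈[0,T], x∈[-R,R]} (|f_n(t,x) − f_m(t,x)| + 𝒩_β^{(1)}(f_n − f_m)(t,x)) → 0 as n, m → ∞, then there exists f ∈ X^β_T such that f_n converges to f in X^β_T. -/
open MeasureTheory Set Filter
open scoped ENNReal

/-- The truncated seminorm
`𝒩_β^{(δ)} f(t,x) = (∫_{|h| ≤ δ} |f(t,x+h) - f(t,x)|² |h|^{-1-2β} dh)^{1/2}`,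
applied in the spatial variable. -/
noncomputable def NN (β δ : ℝ) (f : ℝ → ℝ → ℝ) (t x : ℝ) : ℝ≥0∞ :=
  (∫⁻ h in Set.Icc (-δ) δ,
    ENNReal.ofReal (|f t (x + h) - f t x| ^ 2 * |h| ^ (-1 - 2 * β))) ^ (1/2 : ℝ)

/-- Membership in the space `X^β_T`: `f` is continuous on `[0,T] × ℝ`,
`(t,x) ↦ 𝒩_β^{(1)} f(t,x)` is finite and continuous on `[0,T] × ℝ`, and for every `R > 0`,
`lim_{h → 0} sup_{t ∈ [0,T], x ∈ [-R,R]} 𝒩_β^{(1)}(τ_h f - f)(t,x) = 0`. -/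
def memX (β T : ℝ) (f : ℝ → ℝ → ℝ) : Prop :=
  ContinuousOn (fun p : ℝ × ℝ => f p.1 p.2) (Set.Icc (0:ℝ) T ×ˢ (Set.univ : Set ℝ)) ∧
  (∀ t ∈ Set.Icc (0:ℝ) T, ∀ x : ℝ, NN β 1 f t x ≠ ⊤) ∧
  ContinuousOn (fun p : ℝ × ℝ => (NN β 1 f p.1 p.2).toReal)
    (Set.Icc (0:ℝ) T ×ˢ (Set.univ : Set ℝ)) ∧
  ∀ R > (0:ℝ), Filter.Tendsto
    (fun h : ℝ => ⨆ (t : Set.Icc (0:ℝ) T) (x : Set.Icc (-R) R),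
      NN β 1 (fun t' x' => f t' (x' - h) - f t' x') t.1 x.1)
    (nhds 0) (nhds (0 : ℝ≥0∞))

/-- Convergence `f_n → f` in the space `X^β_T`: for every `R > 0`, uniform convergence of
`f_n` to `f` on `[0,T] × [-R,R]` together with
`sup_{t ∈ [0,T], x ∈ [-R,R]} 𝒩_β^{(1)}(f_n - f)(t,x) → 0`. -/
def convX (β T : ℝ) (fn : ℕ → ℝ → ℝ → ℝ) (f : ℝ → ℝ → ℝ) : Prop :=
  ∀ R > (0:ℝ), ∀ ε > (0:ℝ), ∃ N : ℕ, ∀ n ≥ N,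
    ∀ t ∈ Set.Icc (0:ℝ) T, ∀ x ∈ Set.Icc (-R) R,
      |fn n t x - f t x| ≤ ε ∧
      NN β 1 (fun t' x' => fn n t' x' - f t' x') t x ≤ ENNReal.ofReal ε

/-- The seminorm as an `L²` norm of a weighted increment. -/
theorem NN_eq_lintegral_rpow (β δ : ℝ) (f : ℝ → ℝ → ℝ) (t x : ℝ) :
    NN β δ f t x = (∫⁻ h in Set.Icc (-δ) δ,
      (ENNReal.ofReal (|f t (x + h) - f t x| * |h| ^ ((-1 - 2 * β) / 2))) ^ (2 : ℝ))
        ^ (1 / 2 : ℝ) := by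
  unfold NN
  congr 1
  refine lintegral_congr fun h => ?_
  have hw : (|h| ^ ((-1 - 2 * β) / 2)) ^ 2 = |h| ^ (-1 - 2 * β) := by
    rw [← Real.rpow_natCast, ← Real.rpow_mul (abs_nonneg h)]
    congr 1
    push_cast
    ring
  rw [ENNReal.ofReal_rpow_of_nonneg (by positivity) (by norm_num), Real.rpow_two, mul_pow, hw]

/-- The triangle inequality for the seminorm. -/
theorem NN_le_add {β δ t : ℝ} {u v w : ℝ → ℝ → ℝ} (hu : Continuous (u t))
    (hv : Continuous (v t)) (hw : ∀ y, w t y = u t y + v t y) (x : ℝ) :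
    NN β δ w t x ≤ NN β δ u t x + NN β δ v t x := by
  simp only [NN_eq_lintegral_rpow]
  have hmeas : ∀ k : ℝ → ℝ, Continuous k → AEMeasurable (fun h => ENNReal.ofReal
      (|k (x + h) - k x| * |h| ^ ((-1 - 2 * β) / 2))) (volume.restrict (Set.Icc (-δ) δ)) := by
    intro k hk
    have hk' : Measurable fun h => k (x + h) := by fun_prop
    exact Measurable.aemeasurable (by fun_prop)
  refine le_trans ?_ (ENNReal.lintegral_Lp_add_le (hmeas _ hu) (hmeas _ hv) one_le_two)
  gcongr with h
  simp only [Pi.add_apply]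
  rw [← ENNReal.ofReal_add (by positivity) (by positivity), ← add_mul, hw, hw]
  gcongr
  rw [show u t (x + h) + v t (x + h) - (u t x + v t x)
    = (u t (x + h) - u t x) + (v t (x + h) - v t x) by ring]
  exact abs_add_le _ _

/-- The seminorm is lower semicontinuous under pointwise convergence. -/
theorem NN_le_of_tendsto {β δ t x : ℝ} {u : ℕ → ℝ → ℝ → ℝ} {v : ℝ → ℝ → ℝ}
    (hu : ∀ m, Continuous (u m t))
    (hlim : ∀ y, Tendsto (fun m => u m t y) atTop (nhds (v t y))) {c : ℝ≥0∞}
    (hc : ∀ᶠ m in atTop, NN β δ (u m) t x ≤ c) : NN β δ v t x ≤ c := by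
  have hrpow : ∀ a : ℝ≥0∞, a ^ (1 / 2 : ℝ) ≤ c ↔ a ≤ c ^ (2 : ℝ) := fun a => by
    rw [one_div, ENNReal.rpow_inv_le_iff two_pos]
  unfold NN at hc ⊢
  simp only [hrpow] at hc ⊢
  calc _ = ∫⁻ h in Set.Icc (-δ) δ, liminf (fun m => ENNReal.ofReal
        (|u m t (x + h) - u m t x| ^ 2 * |h| ^ (-1 - 2 * β))) atTop := by
        refine lintegral_congr fun h => (Tendsto.liminf_eq ?_).symm
        exact ENNReal.tendsto_ofReal ((((hlim (x + h)).sub (hlim x)).abs.pow 2).mul_const _)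
    _ ≤ liminf (fun m => ∫⁻ h in Set.Icc (-δ) δ, ENNReal.ofReal
        (|u m t (x + h) - u m t x| ^ 2 * |h| ^ (-1 - 2 * β))) atTop := by
        refine lintegral_liminf_le fun m => ?_
        have hm : Measurable fun h => u m t (x + h) := by
          have := hu m
          fun_prop
        fun_prop
    _ ≤ c ^ (2 : ℝ) := liminf_le_of_le (by isBoundedDefault) fun b hb => by
        obtain ⟨m, h₁, h₂⟩ := (hb.and hc).exists
        exact h₁.trans h₂

theorem NN_congr {β δ t t' x x' : ℝ} {u v : ℝ → ℝ → ℝ}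
    (h : ∀ k, |u t (x + k) - u t x| = |v t' (x' + k) - v t' x'|) :
    NN β δ u t x = NN β δ v t' x' := by
  simp only [NN, h]

theorem NN_sub_comm (β δ : ℝ) (u v : ℝ → ℝ → ℝ) (t x : ℝ) :
    NN β δ (fun t' x' => u t' x' - v t' x') t x = NN β δ (fun t' x' => v t' x' - u t' x') t x :=
  NN_congr fun k => by
    rw [← abs_neg]
    congr 1
    ring

/-- A limit, uniform on bounded sets, of functions continuous on a strip is continuous there. -/
theorem continuousOn_strip_of_uniform_limit {T : ℝ} {F : ℕ → ℝ × ℝ → ℝ} {G : ℝ × ℝ → ℝ}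
    (hF : ∀ n, ContinuousOn (F n) (Set.Icc (0 : ℝ) T ×ˢ (Set.univ : Set ℝ)))
    (h : ∀ R > (0 : ℝ), ∀ ε > (0 : ℝ), ∃ N : ℕ, ∀ n ≥ N, ∀ t ∈ Set.Icc (0 : ℝ) T,
      ∀ x ∈ Set.Icc (-R) R, |F n (t, x) - G (t, x)| ≤ ε) :
    ContinuousOn G (Set.Icc (0 : ℝ) T ×ˢ (Set.univ : Set ℝ)) := by
  have hlim : TendstoLocallyUniformlyOn F G atTop (Set.Icc (0 : ℝ) T ×ˢ (Set.univ : Set ℝ)) := by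
    rw [Metric.tendstoLocallyUniformlyOn_iff]
    intro ε hε p hp
    obtain ⟨N, hN⟩ := h (|p.2| + 1) (by positivity) (ε / 2) (by positivity)
    refine ⟨(Set.Icc (0 : ℝ) T ×ˢ Set.univ) ∩ {q | |q.2| < |p.2| + 1},
      inter_mem_nhdsWithin _ (IsOpen.mem_nhds (isOpen_lt (by fun_prop) (by fun_prop)) ?_), ?_⟩
    · simp
    · filter_upwards [eventually_ge_atTop N] with n hn q hq
      rw [dist_comm, Real.dist_eq]
      have := hN n hn q.1 hq.1.1 q.2 (abs_le.mp (le_of_lt hq.2))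
      simp only [Prod.mk.eta] at this
      linarith
  exact hlim.continuousOn (Frequently.of_forall hF)

theorem abs_toReal_sub_toReal_le {a b : ℝ≥0∞} {ε : ℝ} (hε : 0 ≤ ε) (ha : a ≠ ⊤) (hb : b ≠ ⊤)
    (hab : a ≤ ENNReal.ofReal ε + b) (hba : b ≤ ENNReal.ofReal ε + a) :
    |a.toReal - b.toReal| ≤ ε := by
  have key : ∀ {c d : ℝ≥0∞}, d ≠ ⊤ → c ≤ ENNReal.ofReal ε + d → c.toReal ≤ ε + d.toReal := by
    intro c d hd hcd
    have := ENNReal.toReal_mono (by simp [hd]) hcd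
    rwa [ENNReal.toReal_add ENNReal.ofReal_ne_top hd, ENNReal.toReal_ofReal hε] at this
  have h₁ := key hb hab
  have h₂ := key ha hba
  rw [abs_le]
  constructor <;> linarith

theorem continuous_slice_of_continuousOn_strip {T : ℝ} {f : ℝ → ℝ → ℝ}
    (hf : ContinuousOn (fun p : ℝ × ℝ => f p.1 p.2) (Set.Icc (0 : ℝ) T ×ˢ (Set.univ : Set ℝ)))
    {t : ℝ} (ht : t ∈ Set.Icc (0 : ℝ) T) : Continuous (f t) := by
  have h : ContinuousOn (fun x : ℝ => f t x) Set.univ :=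
    hf.comp (f := fun x : ℝ => (t, x)) (by fun_prop) fun x _ => ⟨ht, mem_univ x⟩
  exact continuousOn_univ.mp h

/-- `X^β_T` is closed under convergence of sequences. -/
theorem memX_of_convX {β T : ℝ} {f : ℕ → ℝ → ℝ → ℝ} {g : ℝ → ℝ → ℝ}
    (hmem : ∀ n, memX β T (f n)) (hconv : convX β T f g) : memX β T g := by
  have hfc : ∀ n, ∀ t ∈ Set.Icc (0 : ℝ) T, Continuous (f n t) := fun n t ht =>
    continuous_slice_of_continuousOn_strip (hmem n).1 ht
  have hg : ContinuousOn (fun p : ℝ × ℝ => g p.1 p.2)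
      (Set.Icc (0 : ℝ) T ×ˢ (Set.univ : Set ℝ)) :=
    continuousOn_strip_of_uniform_limit (fun n => (hmem n).1) fun R hR ε hε =>
      (hconv R hR ε hε).imp fun N hN n hn t ht x hx => (hN n hn t ht x hx).1
  have hgc : ∀ t ∈ Set.Icc (0 : ℝ) T, Continuous (g t) := fun t ht =>
    continuous_slice_of_continuousOn_strip hg ht
  have hle : ∀ n, ∀ t ∈ Set.Icc (0 : ℝ) T, ∀ x,
      NN β 1 g t x ≤ NN β 1 (fun t' x' => f n t' x' - g t' x') t x + NN β 1 (f n) t x := by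
    intro n t ht x
    rw [NN_sub_comm]
    exact NN_le_add ((hgc t ht).sub (hfc n t ht)) (hfc n t ht) (fun y => by ring) x
  have hge : ∀ n, ∀ t ∈ Set.Icc (0 : ℝ) T, ∀ x,
      NN β 1 (f n) t x ≤ NN β 1 (fun t' x' => f n t' x' - g t' x') t x + NN β 1 g t x :=
    fun n t ht x => NN_le_add ((hfc n t ht).sub (hgc t ht)) (hgc t ht) (fun y => by ring) x
  have hfin : ∀ t ∈ Set.Icc (0 : ℝ) T, ∀ x : ℝ, NN β 1 g t x ≠ ⊤ := by
    intro t ht x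
    obtain ⟨N, hN⟩ := hconv (|x| + 1) (by positivity) 1 one_pos
    have hNx := (hN N le_rfl t ht x (abs_le.mp (by linarith))).2
    exact ne_top_of_le_ne_top (ENNReal.add_ne_top.mpr
      ⟨ne_top_of_le_ne_top ENNReal.ofReal_ne_top hNx, (hmem N).2.1 t ht x⟩) (hle N t ht x)
  refine ⟨hg, hfin, ?_, ?_⟩
  · refine continuousOn_strip_of_uniform_limit (fun n => (hmem n).2.2.1) fun R hR ε hε =>
      (hconv R hR ε hε).imp fun N hN n hn t ht x hx => ?_
    have hNx := (hN n hn t ht x hx).2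
    exact abs_toReal_sub_toReal_le hε.le ((hmem n).2.1 t ht x) (hfin t ht x)
      ((hge n t ht x).trans (by gcongr)) ((hle n t ht x).trans (by gcongr))
  · intro R hR
    rw [ENNReal.tendsto_nhds_zero]
    intro ε hε
    obtain ⟨r, hr, hrε⟩ : ∃ r : ℝ, 0 < r ∧ ENNReal.ofReal r ≤ ε / 3 := by
      obtain ⟨r, hr, hrε⟩ := ENNReal.lt_iff_exists_nnreal_btwn.mp
        (ENNReal.div_pos hε.ne' (by norm_num : (3 : ℝ≥0∞) ≠ ⊤))
      exact ⟨r, by exact_mod_cast hr, by simpa using hrε.le⟩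
    obtain ⟨N, hN⟩ := hconv (R + 1) (by linarith) r hr
    have hshift := ENNReal.tendsto_nhds_zero.mp ((hmem N).2.2.2 R hR) (ε / 3)
      (ENNReal.div_pos hε.ne' (by norm_num))
    filter_upwards [hshift, Metric.ball_mem_nhds (0 : ℝ) one_pos] with h hh hball
    have habs : |h| < 1 := by simpa using hball
    obtain ⟨hlo, hhi⟩ := abs_lt.mp habs
    refine iSup₂_le fun t x => ?_
    obtain ⟨hx₁, hx₂⟩ := x.2
    have hf := hfc N t.1 t.2
    have hg' := hgc t.1 t.2
    have htrans : NN β 1 (fun t' x' => g t' (x' - h) - f N t' (x' - h)) t.1 x.1 ≤ ε / 3 := by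
      refine le_trans (le_of_eq ?_)
        ((hN N le_rfl t.1 t.2 (x.1 - h) ⟨by linarith, by linarith⟩).2.trans hrε)
      rw [NN_sub_comm]
      refine NN_congr fun k => ?_
      rw [show x.1 + k - h = x.1 - h + k by ring]
    have hmid : NN β 1 (fun t' x' => f N t' (x' - h) - f N t' x') t.1 x.1 ≤ ε / 3 :=
      le_trans (le_iSup₂ (f := fun (t : Set.Icc (0 : ℝ) T) (x : Set.Icc (-R) R) =>
        NN β 1 (fun t' x' => f N t' (x' - h) - f N t' x') t.1 x.1) t x) hh
    have hend : NN β 1 (fun t' x' => f N t' x' - g t' x') t.1 x.1 ≤ ε / 3 :=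
      (hN N le_rfl t.1 t.2 x.1 ⟨by linarith, by linarith⟩).2.trans hrε
    calc _ ≤ NN β 1 (fun t' x' => g t' (x' - h) - f N t' (x' - h)) t.1 x.1
          + NN β 1 (fun t' x' => f N t' (x' - h) - g t' x') t.1 x.1 :=
          NN_le_add (by fun_prop) (by fun_prop) (fun y => by ring) _
      _ ≤ NN β 1 (fun t' x' => g t' (x' - h) - f N t' (x' - h)) t.1 x.1
          + (NN β 1 (fun t' x' => f N t' (x' - h) - f N t' x') t.1 x.1
          + NN β 1 (fun t' x' => f N t' x' - g t' x') t.1 x.1) := by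
          gcongr
          exact NN_le_add (by fun_prop) (by fun_prop) (fun y => by ring) _
      _ ≤ ε / 3 + (ε / 3 + ε / 3) := by gcongr
      _ = ε := by rw [← add_assoc, ENNReal.add_thirds]

/-- The space `X^β_T` is complete: a sequence in `X^β_T` that is uniformly Cauchy on
`[0,T] × [-R,R]` and Cauchy for the seminorms `sup 𝒩_β^{(1)}` for every `R > 0`
converges in `X^β_T` to some `f ∈ X^β_T`. -/
theorem stmt_4 (β T : ℝ) (hβ : β ∈ Set.Ioo (0:ℝ) 1) (hT : 0 < T)
    (f : ℕ → ℝ → ℝ → ℝ) (hmem : ∀ n, memX β T (f n))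
    (hcauchy : ∀ R > (0:ℝ), ∀ ε > (0:ℝ), ∃ N : ℕ, ∀ m ≥ N, ∀ n ≥ N,
      ∀ t ∈ Set.Icc (0:ℝ) T, ∀ x ∈ Set.Icc (-R) R,
        |f n t x - f m t x| ≤ ε ∧
        NN β 1 (fun t' x' => f n t' x' - f m t' x') t x ≤ ENNReal.ofReal ε) :
    ∃ g : ℝ → ℝ → ℝ, memX β T g ∧ convX β T f g := by
  have hlim : ∀ t ∈ Set.Icc (0 : ℝ) T, ∀ x, ∃ l, Tendsto (fun n => f n t x) atTop (nhds l) := by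
    refine fun t ht x => cauchySeq_tendsto_of_complete (Metric.cauchySeq_iff.mpr fun ε hε => ?_)
    obtain ⟨N, hN⟩ := hcauchy (|x| + 1) (by positivity) (ε / 2) (by positivity)
    refine ⟨N, fun m hm n hn => ?_⟩
    rw [Real.dist_eq]
    linarith [(hN n hn m hm t ht x (abs_le.mp (by linarith))).1]
  choose! g hg using hlim
  have hconv : convX β T f g := by
    intro R hR ε hε
    obtain ⟨N, hN⟩ := hcauchy R hR ε hε
    refine ⟨N, fun n hn t ht x hx => ⟨?_, ?_⟩⟩
    · refine le_of_tendsto (tendsto_const_nhds.sub (hg t ht x)).abs ?_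
      filter_upwards [eventually_ge_atTop N] with m hm
      exact (hN m hm n hn t ht x hx).1
    · refine NN_le_of_tendsto (u := fun m t' x' => f n t' x' - f m t' x')
        (fun m => (continuous_slice_of_continuousOn_strip (hmem n).1 ht).sub
          (continuous_slice_of_continuousOn_strip (hmem m).1 ht))
        (fun y => tendsto_const_nhds.sub (hg t ht y)) ?_
      filter_upwards [eventually_ge_atTop N] with m hm
      exact (hN m hm n hn t ht x hx).2
  exact ⟨g, memX_of_convX hmem hconv, hconv⟩
end

section
/- Let β ∈ (0,1), T > 0, and let f : [0,T]×ℝ → ℝ be a continuous function such that for every fixed x ∈ ℝ the map t ↦ 𝒩_β^{(1)} f(t,x) is finite and continuous on [0,T]. Suppose in addition that for every R > 0, lim_{δ↓0} sup_{t∈[0,T], x∈[-R,R]} ∫_{|y|≤δ} |f(t,x+y) − f(t,x)|² |y|^{-2β-1} dy = 0. Then (t,x) ↦ 𝒩_β^{(1)} f(t,x) is continuous on [0,T]×ℝ, and for every R > 0, lim_{h→0} sup_{t∈[0,T], x∈[-R,R]} 𝒩_β^{(1)}(τ_h f − f)(t,x) = 0; in particular f belongs to X^β_T. -/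
open MeasureTheory Set Filter
open scoped ENNReal

/-- The integral of `|u|²` over `[-1, 1]` against the weight `|y|^a` truncated at `|y| = δ`. -/
noncomputable def truncatedEnergy (a δ : ℝ) (u : ℝ → ℝ) : ℝ :=
  ∫ y in Set.Icc (-1 : ℝ) 1, |u y| ^ 2 * (max |y| δ) ^ a

lemma continuous_max_abs_rpow (a : ℝ) {δ : ℝ} (hδ : 0 < δ) :
    Continuous fun y : ℝ => (max |y| δ) ^ a :=
  (continuous_abs.max continuous_const).rpow_const
    fun _ => Or.inl (lt_max_of_lt_right hδ).ne'

lemma truncatedEnergy_nonneg (a : ℝ) {δ : ℝ} (hδ : 0 < δ) (u : ℝ → ℝ) :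
    0 ≤ truncatedEnergy a δ u :=
  integral_nonneg fun y => by
    have : 0 < max |y| δ := lt_max_of_lt_right hδ
    positivity

lemma continuous_truncatedEnergy {X : Type*} [TopologicalSpace X] [FirstCountableTopology X]
    [LocallyCompactSpace X] (a : ℝ) {δ : ℝ} (hδ : 0 < δ) {u : X → ℝ → ℝ} (hu : Continuous (Function.uncurry u)) :
    Continuous fun p => truncatedEnergy a δ (u p) := by
  refine continuous_parametric_integral_of_continuous ?_ isCompact_Icc
  exact (hu.abs.pow 2).mul ((continuous_max_abs_rpow a hδ).comp continuous_snd)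

lemma ofReal_truncatedEnergy (a : ℝ) {δ : ℝ} (hδ : 0 < δ) {u : ℝ → ℝ} (hu : Continuous u) :
    ENNReal.ofReal (truncatedEnergy a δ u) =
      ∫⁻ y in Set.Icc (-1 : ℝ) 1, ENNReal.ofReal (|u y| ^ 2 * (max |y| δ) ^ a) := by
  refine ofReal_integral_eq_lintegral_ofReal ?_ (Eventually.of_forall fun y => ?_)
  · exact ((hu.abs.pow 2).mul (continuous_max_abs_rpow a hδ)).continuousOn.integrableOn_compact
      isCompact_Icc
  · have : 0 < max |y| δ := lt_max_of_lt_right hδ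
    simp only [Pi.zero_apply]
    positivity

lemma ofReal_truncatedEnergy_le {a δ : ℝ} (ha : a ≤ 0) (hδ : 0 < δ) {u : ℝ → ℝ}
    (hu : Continuous u) (hu0 : u 0 = 0) :
    ENNReal.ofReal (truncatedEnergy a δ u) ≤
      ∫⁻ y in Set.Icc (-1 : ℝ) 1, ENNReal.ofReal (|u y| ^ 2 * |y| ^ a) := by
  rw [ofReal_truncatedEnergy a hδ hu]
  refine lintegral_mono fun y => ENNReal.ofReal_le_ofReal ?_
  rcases eq_or_ne y 0 with rfl | hy
  · simp [hu0]
  · exact mul_le_mul_of_nonneg_left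
      (Real.rpow_le_rpow_of_nonpos (abs_pos.2 hy) (le_max_left _ _) ha) (by positivity)

lemma lintegral_le_truncatedEnergy_add (a : ℝ) {δ : ℝ} (hδ : 0 < δ) {u : ℝ → ℝ}
    (hu : Continuous u) :
    ∫⁻ y in Set.Icc (-1 : ℝ) 1, ENNReal.ofReal (|u y| ^ 2 * |y| ^ a) ≤
      ENNReal.ofReal (truncatedEnergy a δ u) +
        ∫⁻ y in Set.Icc (-δ) δ, ENNReal.ofReal (|u y| ^ 2 * |y| ^ a) := by
  rw [ofReal_truncatedEnergy a hδ hu, ← lintegral_indicator measurableSet_Icc (μ := volume)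
    (s := Set.Icc (-δ) δ)]
  have hmeas : Measurable fun y : ℝ => ENNReal.ofReal (|u y| ^ 2 * (max |y| δ) ^ a) :=
    ((hu.abs.pow 2).mul (continuous_max_abs_rpow a hδ)).measurable.ennreal_ofReal
  refine le_trans ?_ (add_le_add_right (setLIntegral_le_lintegral (Set.Icc (-1 : ℝ) 1) _) _)
  rw [← lintegral_add_left hmeas]
  refine lintegral_mono fun y => ?_
  by_cases hy : y ∈ Set.Icc (-δ) δ
  · simp [Set.indicator_of_mem hy]
  · have : δ ≤ |y| := by
      by_contra! h
      exact hy (abs_le.1 h.le)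
    simp [max_eq_left this]

lemma lintegral_sub_sq_le {μ : Measure ℝ} (a : ℝ) {u v : ℝ → ℝ} (hu : Continuous u) :
    ∫⁻ y, ENNReal.ofReal (|u y - v y| ^ 2 * |y| ^ a) ∂μ ≤
      2 * (∫⁻ y, ENNReal.ofReal (|u y| ^ 2 * |y| ^ a) ∂μ) +
        2 * ∫⁻ y, ENNReal.ofReal (|v y| ^ 2 * |y| ^ a) ∂μ := by
  have hmeas : Measurable fun y : ℝ => ENNReal.ofReal (|u y| ^ 2 * |y| ^ a) :=
    ((hu.abs.pow 2).measurable.mul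
      (continuous_abs.measurable.pow_const a)).ennreal_ofReal
  rw [← lintegral_const_mul' _ _ (by simp), ← lintegral_const_mul' _ _ (by simp),
    ← lintegral_add_left (hmeas.const_mul 2)]
  refine lintegral_mono fun y => ?_
  have hw : 0 ≤ |y| ^ a := by positivity
  rw [← ENNReal.ofReal_ofNat 2, ← ENNReal.ofReal_mul zero_le_two,
    ← ENNReal.ofReal_mul zero_le_two, ← ENNReal.ofReal_add (by positivity) (by positivity)]
  refine ENNReal.ofReal_le_ofReal ?_
  simp only [sq_abs]
  nlinarith [mul_nonneg (sq_nonneg (u y + v y)) hw]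

/-- Functions on `ℝ × ℝ` whose spatial increments have uniformly small weighted energy near `0`
have a continuous weighted energy. -/
lemma continuousOn_lintegral_of_small {a : ℝ} (ha : a ≤ 0) {s : Set ℝ} {g : ℝ → ℝ → ℝ}
    (hg : Continuous (Function.uncurry g))
    (hfin : ∀ t ∈ s, ∀ x, ∫⁻ y in Set.Icc (-1 : ℝ) 1,
      ENNReal.ofReal (|g t (x + y) - g t x| ^ 2 * |y| ^ a) ≠ ⊤)
    (hsmall : ∀ R > 0, ∀ ε > 0, ∃ δ > 0, ∀ t ∈ s, ∀ x ∈ Set.Icc (-R) R,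
      ∫⁻ y in Set.Icc (-δ) δ, ENNReal.ofReal (|g t (x + y) - g t x| ^ 2 * |y| ^ a) ≤
        ENNReal.ofReal ε) :
    ContinuousOn (fun p : ℝ × ℝ => (∫⁻ y in Set.Icc (-1 : ℝ) 1,
      ENNReal.ofReal (|g p.1 (p.2 + y) - g p.1 p.2| ^ 2 * |y| ^ a)).toReal) (s ×ˢ Set.univ) := by
  refine continuousOn_of_locally_uniform_approx_of_continuousWithinAt fun p hp U hU => ?_
  obtain ⟨ε, hε, hεU⟩ := Metric.mem_uniformity_dist.1 hU
  obtain ⟨δ, hδ, hδs⟩ := hsmall (|p.2| + 1) (by positivity) (ε / 2) (half_pos hε)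
  have hincr : Continuous (Function.uncurry
      fun (q : ℝ × ℝ) (y : ℝ) => g q.1 (q.2 + y) - g q.1 q.2) := by
    have h₁ := hg.comp (f := fun z : (ℝ × ℝ) × ℝ => (z.1.1, z.1.2 + z.2)) (by fun_prop)
    have h₂ := hg.comp (f := fun z : (ℝ × ℝ) × ℝ => (z.1.1, z.1.2)) (by fun_prop)
    exact h₁.sub h₂
  refine ⟨_, inter_mem self_mem_nhdsWithin
    (mem_nhdsWithin_of_mem_nhds (Metric.ball_mem_nhds p one_pos)),
    fun q => truncatedEnergy a δ fun y => g q.1 (q.2 + y) - g q.1 q.2,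
    (continuous_truncatedEnergy a hδ hincr).continuousWithinAt, ?_⟩
  rintro q ⟨hqs, hqp⟩
  refine hεU ?_
  have hu : Continuous fun y => g q.1 (q.2 + y) - g q.1 q.2 :=
    hincr.comp (Continuous.prodMk_right q)
  have hq2 : q.2 ∈ Set.Icc (-(|p.2| + 1)) (|p.2| + 1) := by
    have h : dist q.2 p.2 < 1 := (le_max_right _ _).trans_lt (Metric.mem_ball.1 hqp)
    rw [Real.dist_eq] at h
    rw [Set.mem_Icc, ← abs_le]
    linarith [abs_sub_abs_le_abs_sub q.2 p.2]
  have hle := ENNReal.toReal_mono (hfin q.1 hqs.1 q.2)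
    (ofReal_truncatedEnergy_le ha hδ hu (by simp))
  have hge := ENNReal.toReal_mono (by finiteness) ((lintegral_le_truncatedEnergy_add a hδ hu).trans
    (add_le_add_right (hδs q.1 hqs.1 q.2 hq2) _))
  have h0 := truncatedEnergy_nonneg a hδ fun y => g q.1 (q.2 + y) - g q.1 q.2
  rw [ENNReal.toReal_ofReal h0] at hle
  rw [ENNReal.toReal_add (by finiteness) (by finiteness), ENNReal.toReal_ofReal h0,
    ENNReal.toReal_ofReal (half_pos hε).le] at hge
  rw [Real.dist_eq, abs_lt]
  constructor <;> linarith

/-- Functions on `ℝ × ℝ` whose spatial increments have uniformly small weighted energy near `0`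
are translation continuous in the weighted energy, uniformly on compact sets. -/
lemma eventually_lintegral_translate_le {a : ℝ} {s : Set ℝ} (hs : IsCompact s)
    {g : ℝ → ℝ → ℝ} (hg : Continuous (Function.uncurry g))
    (hsmall : ∀ R > 0, ∀ ε > 0, ∃ δ > 0, ∀ t ∈ s, ∀ x ∈ Set.Icc (-R) R,
      ∫⁻ y in Set.Icc (-δ) δ, ENNReal.ofReal (|g t (x + y) - g t x| ^ 2 * |y| ^ a) ≤
        ENNReal.ofReal ε) {R : ℝ} (hR : 0 < R) {ε : ℝ} (hε : 0 < ε) :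
    ∀ᶠ h in nhds (0 : ℝ), ∀ t ∈ s, ∀ x ∈ Set.Icc (-R) R,
      ∫⁻ y in Set.Icc (-1 : ℝ) 1, ENNReal.ofReal
        (|(g t (x + y - h) - g t (x + y)) - (g t (x - h) - g t x)| ^ 2 * |y| ^ a) ≤
        ENNReal.ofReal ε := by
  obtain ⟨δ, hδ, hδs⟩ := hsmall (R + 1) (by positivity) (ε / 5) (by positivity)
  let D : ℝ × ℝ × ℝ → ℝ → ℝ := fun q y =>
    (g q.2.1 (q.2.2 + y - q.1) - g q.2.1 (q.2.2 + y)) - (g q.2.1 (q.2.2 - q.1) - g q.2.1 q.2.2)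
  have hD : Continuous (Function.uncurry D) := by
    have h₁ := hg.comp (f := fun z : (ℝ × ℝ × ℝ) × ℝ => (z.1.2.1, z.1.2.2 + z.2 - z.1.1))
      (by fun_prop)
    have h₂ := hg.comp (f := fun z : (ℝ × ℝ × ℝ) × ℝ => (z.1.2.1, z.1.2.2 + z.2)) (by fun_prop)
    have h₃ := hg.comp (f := fun z : (ℝ × ℝ × ℝ) × ℝ => (z.1.2.1, z.1.2.2 - z.1.1)) (by fun_prop)
    have h₄ := hg.comp (f := fun z : (ℝ × ℝ × ℝ) × ℝ => (z.1.2.1, z.1.2.2)) (by fun_prop)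
    exact (h₁.sub h₂).sub (h₃.sub h₄)
  have hK := continuous_truncatedEnergy a hδ hD
  have hev : ∀ᶠ h in nhds (0 : ℝ), ∀ q ∈ s ×ˢ Set.Icc (-R) R,
      truncatedEnergy a δ (D (h, q)) < ε / 5 := by
    refine (hs.prod isCompact_Icc).eventually_forall_of_forall_eventually fun q _ => ?_
    refine hK.continuousAt.eventually_lt continuousAt_const ?_
    simp only [truncatedEnergy, D, sub_zero, sub_self, abs_zero]
    simpa using hε
  filter_upwards [hev, Metric.ball_mem_nhds (0 : ℝ) one_pos] with h hh hball t ht x hx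
  have hh1 : |h| < 1 := by simpa using hball
  obtain ⟨hh2, hh3⟩ := abs_lt.1 hh1
  have hcont : ∀ z, Continuous fun y => g t (z + y) - g t z := fun z =>
    (hg.comp (f := fun y : ℝ => (t, z + y)) (by fun_prop)).sub continuous_const
  have hsplit := lintegral_sub_sq_le (μ := volume.restrict (Set.Icc (-δ) δ)) a
    (v := fun y => g t (x + y) - g t x) (hcont (x - h))
  have hDeq : ∀ y, g t (x - h + y) - g t (x - h) - (g t (x + y) - g t x) =
      (g t (x + y - h) - g t (x + y)) - (g t (x - h) - g t x) := fun y => by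
    rw [show x - h + y = x + y - h by ring]
    ring
  simp only [hDeq] at hsplit
  have h₁ := hδs t ht (x - h) ⟨by linarith [hx.1], by linarith [hx.2]⟩
  have h₂ := hδs t ht x ⟨by linarith [hx.1], by linarith [hx.2]⟩
  calc _ ≤ ENNReal.ofReal (truncatedEnergy a δ (D (h, t, x))) + _ :=
        lintegral_le_truncatedEnergy_add a hδ (hD.comp (Continuous.prodMk_right (h, t, x)))
    _ ≤ ENNReal.ofReal (ε / 5) +
        (2 * ENNReal.ofReal (ε / 5) + 2 * ENNReal.ofReal (ε / 5)) := by
      refine add_le_add (ENNReal.ofReal_le_ofReal (hh (t, x) ⟨ht, hx⟩).le) (hsplit.trans ?_)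
      gcongr
    _ = ENNReal.ofReal ε := by
      have hε5 : 0 ≤ ε / 5 := by positivity
      rw [← ENNReal.ofReal_ofNat 2, ← ENNReal.ofReal_mul zero_le_two,
        ← ENNReal.ofReal_add (by positivity) (by positivity),
        ← ENNReal.ofReal_add (by positivity) (by positivity)]
      congr 1
      ring

/-- If `f` is continuous on `[0,T] × ℝ`, `t ↦ 𝒩_β^{(1)} f(t,x)` is finite and continuous
for every fixed `x`, and for every `R > 0`,
`lim_{δ ↓ 0} sup_{t ∈ [0,T], x ∈ [-R,R]} ∫_{|y| ≤ δ} |f(t,x+y) - f(t,x)|² |y|^{-2β-1} dy = 0`,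
then `𝒩_β^{(1)} f` is (jointly) continuous and `f` belongs to `X^β_T`. -/
theorem stmt_5 (β T : ℝ) (hβ : β ∈ Set.Ioo (0:ℝ) 1) (hT : 0 < T)
    (f : ℝ → ℝ → ℝ)
    (hcont : ContinuousOn (fun p : ℝ × ℝ => f p.1 p.2)
      (Set.Icc (0:ℝ) T ×ˢ (Set.univ : Set ℝ)))
    (hfin : ∀ x : ℝ, ∀ t ∈ Set.Icc (0:ℝ) T, NN β 1 f t x ≠ ⊤)
    (htcont : ∀ x : ℝ, ContinuousOn (fun t => (NN β 1 f t x).toReal) (Set.Icc (0:ℝ) T))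
    (hsmall : ∀ R > (0:ℝ), Filter.Tendsto
      (fun δ : ℝ => ⨆ (t : Set.Icc (0:ℝ) T) (x : Set.Icc (-R) R),
        ∫⁻ y in Set.Icc (-δ) δ,
          ENNReal.ofReal (|f t.1 (x.1 + y) - f t.1 x.1| ^ 2 * |y| ^ (-2 * β - 1)))
      (nhdsWithin 0 (Set.Ioi 0)) (nhds (0 : ℝ≥0∞))) :
    memX β T f := by
  obtain ⟨hβ0, -⟩ := hβ
  have ha : -1 - 2 * β ≤ 0 := by linarith
  let g : ℝ → ℝ → ℝ := fun t => f (Set.projIcc 0 T hT.le t)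
  have hgf : ∀ t ∈ Set.Icc (0 : ℝ) T, g t = f t := fun t ht => by
    simp [g, Set.projIcc_of_mem hT.le ht]
  have hg : Continuous (Function.uncurry g) :=
    hcont.comp_continuous (f := fun q : ℝ × ℝ => ((Set.projIcc 0 T hT.le q.1 : ℝ), q.2))
      (by fun_prop) fun q => ⟨(Set.projIcc 0 T hT.le q.1).2, Set.mem_univ _⟩
  have hgsmall : ∀ R > 0, ∀ ε > 0, ∃ δ > 0, ∀ t ∈ Set.Icc (0 : ℝ) T, ∀ x ∈ Set.Icc (-R) R,
      ∫⁻ y in Set.Icc (-δ) δ,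
        ENNReal.ofReal (|g t (x + y) - g t x| ^ 2 * |y| ^ (-1 - 2 * β)) ≤ ENNReal.ofReal ε := by
    intro R hR ε hε
    obtain ⟨δ, hδ, hδ0⟩ := ((ENNReal.tendsto_nhds_zero.1 (hsmall R hR) (ENNReal.ofReal ε)
      (ENNReal.ofReal_pos.2 hε)).and self_mem_nhdsWithin).exists
    refine ⟨δ, hδ0, fun t ht x hx => ?_⟩
    rw [hgf t ht, show -1 - 2 * β = -2 * β - 1 by ring]
    exact iSup_le_iff.1 (iSup_le_iff.1 hδ ⟨t, ht⟩) ⟨x, hx⟩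
  refine ⟨hcont, fun t ht x => hfin x t ht, ?_, fun R hR => ?_⟩
  · have hE := continuousOn_lintegral_of_small ha hg (s := Set.Icc 0 T) (fun t ht x htop => by
      refine hfin x t ht ?_
      rw [hgf t ht] at htop
      rw [NN, htop]
      simp) hgsmall
    refine (hE.rpow_const (p := 1 / 2) fun _ _ => Or.inr (by norm_num)).congr fun p hp => ?_
    simp only [NN, ← ENNReal.toReal_rpow, hgf p.1 hp.1]
  · refine ENNReal.tendsto_nhds_zero.2 fun ε hε => ?_
    obtain ⟨η, hη0, hηε⟩ := ENNReal.lt_iff_exists_nnreal_btwn.1 (ENNReal.pow_pos hε 2)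
    filter_upwards [eventually_lintegral_translate_le isCompact_Icc hg hgsmall hR
      (NNReal.coe_pos.2 (ENNReal.coe_pos.1 hη0))] with h hh
    refine iSup₂_le fun t x => ?_
    have hle := (hh t.1 t.2 x.1 x.2).trans (ENNReal.ofReal_coe_nnreal.trans_le hηε.le)
    rw [hgf t.1 t.2] at hle
    calc _ ≤ (ε ^ 2) ^ (1 / 2 : ℝ) := ENNReal.rpow_le_rpow hle (by norm_num)
      _ = ε := by
        rw [← ENNReal.rpow_natCast, ← ENNReal.rpow_mul]
        norm_num
end

section
/- Let β ∈ (0,1), T > 0, and let φ ∈ C^∞(ℝ) be supported in [-1,1] with 0 ≤ φ ≤ 1 and ∫_ℝ φ(x) dx = 1; set φ_n(x) = n φ(nx). If f ∈ X^β_T and f*φ_n denotes the convolution of f with φ_n in the spatial variable, then f*φ_n converges to f in X^β_T as n → ∞; that is, for every R > 0, f*φ_n → f uniformly on [0,T]×[-R,R] and sup_{t∈[0,T], x∈[-R,R]} 𝒩_β^{(1)}(f*φ_n − f)(t,x) → 0. -/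
open MeasureTheory Set Filter
open scoped ENNReal

/-- The measure with density `y ↦ n φ(n y)`, the `n`-th rescaling of the mollifier `φ`. -/
noncomputable def mollifierMeasure (φ : ℝ → ℝ) (n : ℕ) : Measure ℝ :=
  volume.withDensity fun y => ENNReal.ofReal ((n : ℝ) * φ ((n : ℝ) * y))

theorem integral_mollifierMeasure {φ : ℝ → ℝ} (hφ : Continuous φ) (hφnonneg : ∀ x, 0 ≤ φ x)
    (n : ℕ) (g : ℝ → ℝ) :
    ∫ y, g y ∂mollifierMeasure φ n = ∫ y, g y * ((n : ℝ) * φ ((n : ℝ) * y)) := by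
  rw [mollifierMeasure, integral_withDensity_eq_integral_toReal_smul (by fun_prop)
    (.of_forall fun _ => ENNReal.ofReal_lt_top)]
  refine integral_congr_ae (.of_forall fun y => ?_)
  have : 0 ≤ (n : ℝ) * φ (n * y) := mul_nonneg n.cast_nonneg (hφnonneg _)
  simp only [ENNReal.toReal_ofReal this, smul_eq_mul, mul_comm (g y)]

theorem isProbabilityMeasure_mollifierMeasure {φ : ℝ → ℝ}
    (hφnonneg : ∀ x, 0 ≤ φ x) (hφint : ∫ x, φ x = 1) {n : ℕ} (hn : 0 < n) :
    IsProbabilityMeasure (mollifierMeasure φ n) := by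
  have hn' : (n : ℝ) ≠ 0 := by positivity
  have hint : Integrable φ := by
    by_contra h
    simp [integral_undef h] at hφint
  constructor
  rw [mollifierMeasure, withDensity_apply _ MeasurableSet.univ, Measure.restrict_univ,
    ← ofReal_integral_eq_lintegral_ofReal ((hint.comp_mul_left' hn').const_mul _)
      (.of_forall fun y => mul_nonneg n.cast_nonneg (hφnonneg _)),
    integral_const_mul, Measure.integral_comp_mul_left, hφint]
  simp [abs_of_nonneg, hn']

theorem ae_mollifierMeasure_abs_le {φ : ℝ → ℝ} (hφ : Continuous φ)
    (hφsupp : Function.support φ ⊆ Icc (-1) 1) {n : ℕ} {δ : ℝ} (hδ : 1 ≤ n * δ) :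
    ∀ᵐ y ∂mollifierMeasure φ n, |y| ≤ δ := by
  rw [mollifierMeasure, ae_withDensity_iff (by fun_prop)]
  refine .of_forall fun y hy => ?_
  have hne : φ (n * y) ≠ 0 := fun h => hy (by simp [h])
  have hmem : |(n : ℝ) * y| ≤ 1 := abs_le.2 (hφsupp hne)
  rw [abs_mul, Nat.abs_cast] at hmem
  have hn : 0 < (n : ℝ) := by
    rcases n.eq_zero_or_pos with rfl | h
    · norm_num at hδ
    · exact_mod_cast h
  exact le_of_mul_le_mul_left (hmem.trans hδ) hn

/-- Jensen's inequality for the square. -/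
theorem enorm_integral_sq_le {α : Type*} [MeasurableSpace α] {μ : Measure α}
    [IsProbabilityMeasure μ] {g : α → ℝ} (hg : AEStronglyMeasurable g μ) :
    ‖∫ y, g y ∂μ‖ₑ ^ 2 ≤ ∫⁻ y, ‖g y‖ₑ ^ 2 ∂μ := by
  have h : ‖∫ y, g y ∂μ‖ₑ ≤ eLpNorm g 2 μ :=
    (enorm_integral_le_lintegral_enorm g).trans <| by
      rw [← eLpNorm_one_eq_lintegral_enorm]
      exact eLpNorm_le_eLpNorm_of_exponent_le (by norm_num) hg
  calc ‖∫ y, g y ∂μ‖ₑ ^ 2 ≤ eLpNorm g 2 μ ^ 2 := by gcongr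
    _ = ∫⁻ y, ‖g y‖ₑ ^ 2 ∂μ := by
      have := eLpNorm_nnreal_pow_eq_lintegral (f := g) (μ := μ) (p := 2) (by norm_num)
      simpa using this

theorem Continuous.integrable_comp_const_sub {μ : Measure ℝ} [IsFiniteMeasure μ] {δ : ℝ}
    (hμ : ∀ᵐ y ∂μ, |y| ≤ δ) {g : ℝ → ℝ} (hg : Continuous g) (x : ℝ) :
    Integrable (fun y => g (x - y)) μ := by
  have hc : Continuous fun y => g (x - y) := by fun_prop
  obtain ⟨C, hC⟩ := (isCompact_Icc (a := -δ) (b := δ)).exists_bound_of_continuousOn hc.continuousOn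
  exact .of_bound hc.aestronglyMeasurable C (hμ.mono fun y hy => hC y (abs_le.1 hy))

theorem NN_le_iff {β δ : ℝ} {f : ℝ → ℝ → ℝ} {t x : ℝ} {c : ℝ≥0∞} :
    NN β δ f t x ≤ c ↔
      ∫⁻ h in Icc (-δ) δ, ‖f t (x + h) - f t x‖ₑ ^ 2 * ENNReal.ofReal (|h| ^ (-1 - 2 * β))
        ≤ c ^ 2 := by
  have h : ∀ h, ENNReal.ofReal (|f t (x + h) - f t x| ^ 2 * |h| ^ (-1 - 2 * β)) =
      ‖f t (x + h) - f t x‖ₑ ^ 2 * ENNReal.ofReal (|h| ^ (-1 - 2 * β)) := fun h => by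
    rw [ENNReal.ofReal_mul (by positivity), ENNReal.ofReal_pow (abs_nonneg _),
      Real.enorm_eq_ofReal_abs]
  simp only [NN, h, one_div]
  rw [ENNReal.rpow_inv_le_iff two_pos, ENNReal.rpow_two]

/-- Averaging with respect to a probability measure is a contraction from `L²(ν × μ)` to `L²(ν)`,
in weighted form. -/
theorem lintegral_enorm_integral_sq_mul_le {μ ν : Measure ℝ} [IsProbabilityMeasure μ] [SFinite ν]
    {D : ℝ → ℝ → ℝ} (hD : Continuous (Function.uncurry D)) {k : ℝ → ℝ≥0∞} (hk : Measurable k) :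
    ∫⁻ h, ‖∫ y, D h y ∂μ‖ₑ ^ 2 * k h ∂ν ≤ ∫⁻ y, (∫⁻ h, ‖D h y‖ₑ ^ 2 * k h ∂ν) ∂μ := by
  have hmeas : Measurable fun p : ℝ × ℝ => ‖D p.1 p.2‖ₑ ^ 2 * k p.1 :=
    (hD.measurable.enorm.pow_const 2).mul (hk.comp measurable_fst)
  rw [← lintegral_lintegral_swap (f := fun h y => ‖D h y‖ₑ ^ 2 * k h) hmeas.aemeasurable]
  refine lintegral_mono fun h => ?_
  have hm : Continuous (D h) := hD.uncurry_left h
  rw [lintegral_mul_const _ (hm.measurable.enorm.pow_const 2)]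
  gcongr
  exact enorm_integral_sq_le hm.aestronglyMeasurable

/-- The seminorm of `f * μ - f` is controlled by those of the increments `τ_y f - f` with `y` in
the support of `μ`. -/
theorem NN_average_sub_le {β r δ t x : ℝ} {μ : Measure ℝ} [IsProbabilityMeasure μ]
    (hμ : ∀ᵐ y ∂μ, |y| ≤ δ) {f : ℝ → ℝ → ℝ} (hf : Continuous (f t)) {c : ℝ≥0∞}
    (hc : ∀ y, |y| ≤ δ → NN β r (fun t' x' => f t' (x' - y) - f t' x') t x ≤ c) :
    NN β r (fun t' x' => (∫ y, f t' (x' - y) ∂μ) - f t' x') t x ≤ c := by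
  rw [NN_le_iff]
  have havg : ∀ h, (∫ y, f t (x + h - y) ∂μ) - f t (x + h) - ((∫ y, f t (x - y) ∂μ) - f t x) =
      ∫ y, (f t (x + h - y) - f t (x + h) - (f t (x - y) - f t x)) ∂μ := fun h => by
    have hi := fun z => hf.integrable_comp_const_sub hμ z
    have hd : ∀ z, Integrable (fun y => f t (z - y) - f t z) μ :=
      fun z => (hi z).sub (integrable_const _)
    rw [integral_sub (hd (x + h)) (hd x), integral_sub (hi _) (integrable_const _),
      integral_sub (hi _) (integrable_const _)]
    simp
  simp only [havg]
  refine (lintegral_enorm_integral_sq_mul_le (by fun_prop) (by fun_prop)).trans ?_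
  refine (lintegral_mono_ae (hμ.mono fun y hy => NN_le_iff.1 (hc y hy))).trans ?_
  simp

theorem abs_average_sub_le {δ ε x : ℝ} {μ : Measure ℝ} [IsProbabilityMeasure μ]
    (hμ : ∀ᵐ y ∂μ, |y| ≤ δ) {g : ℝ → ℝ} (hg : Continuous g)
    (hε : ∀ y, |y| ≤ δ → |g (x - y) - g x| ≤ ε) :
    |(∫ y, g (x - y) ∂μ) - g x| ≤ ε := by
  have h := norm_integral_le_of_norm_le_const (f := fun y => g (x - y) - g x)
    (hμ.mono fun y hy => hε y hy)
  rw [integral_sub (hg.integrable_comp_const_sub hμ x) (integrable_const _)] at h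
  simpa using h

/-- A function continuous on `[0,T] × ℝ` is uniformly continuous in the spatial variable,
locally uniformly. -/
theorem exists_abs_sub_le_of_continuousOn {T R ε : ℝ} (hε : 0 < ε) {f : ℝ → ℝ → ℝ}
    (hf : ContinuousOn (fun p : ℝ × ℝ => f p.1 p.2) (Icc 0 T ×ˢ univ)) :
    ∃ δ > 0, ∀ t ∈ Icc 0 T, ∀ x ∈ Icc (-R) R, ∀ y, |y| < δ → |f t (x - y) - f t x| ≤ ε := by
  have hu := ((isCompact_Icc (a := (0 : ℝ)) (b := T)).prod
    (isCompact_Icc (a := -R - 1) (b := R + 1))).uniformContinuousOn_of_continuous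
    (hf.mono (prod_mono_right (subset_univ _)))
  obtain ⟨δ, hδ, h⟩ := Metric.uniformContinuousOn_iff.1 hu ε hε
  refine ⟨min δ 1, by positivity, fun t ht x hx y hy => ?_⟩
  have hy' := abs_lt.1 (hy.trans_le (min_le_right _ _))
  refine (h (t, x - y) ⟨ht, ?_, ?_⟩ (t, x) ⟨ht, ?_, ?_⟩ ?_).le
  · linarith [hx.1]
  · linarith [hx.2]
  · linarith [hx.1]
  · linarith [hx.2]
  · simpa [Prod.dist_eq, Real.dist_eq, hδ] using hy.trans_le (min_le_left _ _)

/-- Mollification: if `φ ∈ C^∞` is supported in `[-1,1]`, `0 ≤ φ ≤ 1`, `∫ φ = 1`,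
`φ_n(x) = n φ(nx)`, and `f ∈ X^β_T`, then the spatial convolutions `f * φ_n`
converge to `f` in `X^β_T`. -/
theorem stmt_6 (β T : ℝ) (hβ : β ∈ Set.Ioo (0:ℝ) 1) (hT : 0 < T)
    (φ : ℝ → ℝ) (hφsmooth : ContDiff ℝ (⊤ : ℕ∞) φ)
    (hφsupp : Function.support φ ⊆ Set.Icc (-1:ℝ) 1)
    (hφnonneg : ∀ x, 0 ≤ φ x) (hφle : ∀ x, φ x ≤ 1)
    (hφint : ∫ x : ℝ, φ x = 1)
    (f : ℝ → ℝ → ℝ) (hf : memX β T f) :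
    convX β T (fun n t x => ∫ y : ℝ, f t (x - y) * ((n : ℝ) * φ ((n : ℝ) * y))) f := by
  intro R hR ε hε
  obtain ⟨hcont, -, -, hshift⟩ := hf
  have hφ : Continuous φ := hφsmooth.continuous
  obtain ⟨δ₁, hδ₁, h₁⟩ := exists_abs_sub_le_of_continuousOn (R := R) hε hcont
  obtain ⟨δ₂, hδ₂, h₂⟩ := Metric.eventually_nhds_iff.1
    ((hshift R hR).eventually_le_const (ENNReal.ofReal_pos.2 hε))
  obtain ⟨N, hN⟩ := exists_nat_gt (1 / min δ₁ δ₂)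
  have hδ : 0 < min δ₁ δ₂ := lt_min hδ₁ hδ₂
  have hN0 : (0 : ℝ) < N := (by positivity : (0 : ℝ) < 1 / min δ₁ δ₂).trans hN
  refine ⟨N, fun n hn t ht x hx => ?_⟩
  have hNn : (N : ℝ) ≤ n := by exact_mod_cast hn
  have hNδ : 1 / (N : ℝ) < min δ₁ δ₂ := (one_div_lt hδ hN0).1 hN
  have hμ : ∀ᵐ y ∂mollifierMeasure φ n, |y| ≤ 1 / (N : ℝ) :=
    ae_mollifierMeasure_abs_le hφ hφsupp (by rwa [mul_one_div, one_le_div hN0])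
  have := isProbabilityMeasure_mollifierMeasure hφnonneg hφint
    (n := n) (by exact_mod_cast hN0.trans_le hNn)
  have hft : Continuous (f t) := by
    rw [← continuousOn_univ]
    exact hcont.comp (f := fun x => (t, x)) (by fun_prop) fun x _ => ⟨ht, mem_univ x⟩
  simp only [← integral_mollifierMeasure hφ hφnonneg n]
  refine ⟨abs_average_sub_le hμ hft fun y hy =>
    h₁ t ht x hx y (hy.trans_lt (hNδ.trans_le (min_le_left _ _))),
    NN_average_sub_le hμ hft fun y hy => ?_⟩
  refine le_trans ?_ (h₂ (y := y) (by
    simpa using hy.trans_lt (hNδ.trans_le (min_le_right _ _))))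
  exact le_iSup₂ (f := fun (t : Icc (0 : ℝ) T) (x : Icc (-R) R) =>
    NN β 1 (fun t' x' => f t' (x' - y) - f t' x') t.1 x.1) ⟨t, ht⟩ ⟨x, hx⟩
end

section
/- Let β ∈ (0,1), T > 0, and let f : [0,T]×ℝ → ℝ be a continuous function such that for every fixed x ∈ ℝ the map t ↦ 𝒩_β^{(1)} f(t,x) is finite and continuous on [0,T]. Then f belongs to X^β_T if and only if for every R > 0, lim_{δ↓0} sup_{t∈[0,T], x∈[-R,R]} ∫_{|y|≤δ} |f(t,x+y) − f(t,x)|² |y|^{-2β-1} dy = 0. -/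
open MeasureTheory Set Filter
open scoped ENNReal

/-- The weighted square integral `∫_S |g y|² |y|^a dy`. -/
noncomputable def weightedSq (a : ℝ) (S : Set ℝ) (g : ℝ → ℝ) : ℝ≥0∞ :=
  ∫⁻ y in S, ENNReal.ofReal (|g y| ^ 2 * |y| ^ a)

theorem weightedSq_mono {a : ℝ} {S S' : Set ℝ} (h : S ⊆ S') (g : ℝ → ℝ) :
    weightedSq a S g ≤ weightedSq a S' g :=
  lintegral_mono_set h

theorem weightedSq_sub_le {a : ℝ} (S : Set ℝ) {g₁ g₂ : ℝ → ℝ} (h₁ : Continuous g₁) :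
    weightedSq a S (fun y => g₁ y - g₂ y) ≤ 2 * (weightedSq a S g₁ + weightedSq a S g₂) := by
  unfold weightedSq
  rw [← lintegral_add_left (by fun_prop), ← lintegral_const_mul' _ _ (by simp)]
  refine lintegral_mono fun y => ?_
  have hw : 0 ≤ |y| ^ a := by positivity
  rw [← ENNReal.ofReal_add (by positivity) (by positivity),
    show (2 : ℝ≥0∞) = ENNReal.ofReal 2 by simp, ← ENNReal.ofReal_mul (by norm_num)]
  refine ENNReal.ofReal_le_ofReal ?_
  simp only [sq_abs]
  nlinarith [mul_nonneg (sq_nonneg (g₁ y + g₂ y)) hw]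

/-- Splitting `[-1, 1]` into `[-δ, δ]` and (up to a null set) its compact complement. -/
theorem weightedSq_split {a δ : ℝ} (hδ : δ ≤ 1) (g : ℝ → ℝ) :
    weightedSq a (Icc (-1) 1) g =
      weightedSq a (Icc (-δ) δ) g + weightedSq a (Icc (-1) 1 \ Ioo (-δ) δ) g := by
  have h : Icc (-1 : ℝ) 1 ∩ Ioo (-δ) δ = Ioo (-δ) δ :=
    inter_eq_right.2 (Ioo_subset_Icc_self.trans (Icc_subset_Icc (by linarith) hδ))
  unfold weightedSq
  rw [← lintegral_inter_add_sdiff _ (Icc (-1 : ℝ) 1) (measurableSet_Ioo (a := -δ) (b := δ)), h,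
    setLIntegral_congr Ioo_ae_eq_Icc]

/-- On an annulus away from the origin, the weighted square integral is the integral of a
jointly continuous function over a compact set. -/
theorem weightedSq_annulus_eq {a δ : ℝ} (hδ : 0 < δ) {g : ℝ → ℝ} (hg : Continuous g) :
    weightedSq a (Icc (-1) 1 \ Ioo (-δ) δ) g =
      ENNReal.ofReal (∫ y in Icc (-1) 1 \ Ioo (-δ) δ, |g y| ^ 2 * (max |y| δ) ^ a) := by
  have hS : IsCompact (Icc (-1 : ℝ) 1 \ Ioo (-δ) δ) := isCompact_Icc.diff isOpen_Ioo
  have hc : Continuous fun y : ℝ => |g y| ^ 2 * (max |y| δ) ^ a :=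
    (by fun_prop : Continuous fun y => |g y| ^ 2).mul
      ((by fun_prop : Continuous fun y : ℝ => max |y| δ).rpow_const
        fun y => Or.inl (lt_max_of_lt_right hδ).ne')
  rw [ofReal_integral_eq_lintegral_ofReal (hc.continuousOn.integrableOn_compact hS)
    (Eventually.of_forall fun y => by positivity)]
  refine setLIntegral_congr_fun hS.measurableSet fun y hy => ?_
  have : δ ≤ |y| := by
    by_contra! h
    exact hy.2 (abs_lt.1 h)
  simp only [max_eq_left this]

theorem weightedSq_annulus_ne_top {a δ : ℝ} (hδ : 0 < δ) {g : ℝ → ℝ} (hg : Continuous g) :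
    weightedSq a (Icc (-1) 1 \ Ioo (-δ) δ) g ≠ ⊤ := by
  rw [weightedSq_annulus_eq hδ hg]
  exact ENNReal.ofReal_ne_top

theorem continuous_weightedSq_annulus {Y : Type*} [TopologicalSpace Y]
    [FirstCountableTopology Y] [LocallyCompactSpace Y] {a δ : ℝ} (hδ : 0 < δ) {G : Y → ℝ → ℝ}
    (hG : Continuous G.uncurry) :
    Continuous fun q => weightedSq a (Icc (-1) 1 \ Ioo (-δ) δ) (G q) := by
  have hGq (q : Y) : Continuous (G q) := hG.comp (by fun_prop : Continuous fun y : ℝ => (q, y))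
  simp_rw [fun q => weightedSq_annulus_eq (a := a) hδ (hGq q)]
  refine ENNReal.continuous_ofReal.comp (continuous_parametric_integral_of_continuous
    (f := fun q y => |G q y| ^ 2 * (max |y| δ) ^ a) ?_ (isCompact_Icc.diff isOpen_Ioo))
  have h : Continuous fun p : Y × ℝ => |G.uncurry p| ^ 2 * (max |p.2| δ) ^ a :=
    (by fun_prop : Continuous fun p => |G.uncurry p| ^ 2).mul
      ((by fun_prop : Continuous fun p : Y × ℝ => max |p.2| δ).rpow_const
        fun y => Or.inl (lt_max_of_lt_right hδ).ne')
  exact h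

theorem exists_weightedSq_Icc_lt {a : ℝ} {g : ℝ → ℝ}
    (hfin : weightedSq a (Icc (-1) 1) g ≠ ⊤) {ε : ℝ≥0∞} (hε : 0 < ε) :
    ∃ δ : ℝ, 0 < δ ∧ δ ≤ 1 ∧ weightedSq a (Icc (-δ) δ) g < ε := by
  obtain ⟨d, hd, hd'⟩ := exists_pos_setLIntegral_lt_of_measure_lt hfin hε.ne'
  obtain ⟨r, hr0, hr⟩ := ENNReal.lt_iff_exists_nnreal_btwn.1 hd
  have hr0' : (0 : ℝ) < r := by exact_mod_cast hr0
  refine ⟨min 1 (r / 2), by positivity, min_le_left _ _, ?_⟩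
  have hsub : Icc (-(min 1 ((r : ℝ) / 2))) (min 1 (r / 2)) ⊆ Icc (-1) 1 :=
    Icc_subset_Icc (neg_le_neg (min_le_left _ _)) (min_le_left _ _)
  have := hd' (Icc (-(min 1 ((r : ℝ) / 2))) (min 1 (r / 2))) (by
    refine (Measure.restrict_apply_le _ _).trans_lt (lt_of_le_of_lt ?_ hr)
    rw [Real.volume_Icc, ← ENNReal.ofReal_coe_nnreal]
    refine ENNReal.ofReal_le_ofReal ?_
    have := min_le_right 1 ((r : ℝ) / 2)
    linarith)
  rwa [Measure.restrict_restrict measurableSet_Icc, inter_eq_left.2 hsub] at this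

section Increments

variable {X : Type*} [TopologicalSpace X] {u : X → ℝ → ℝ}

theorem continuous_increment (hu : Continuous u.uncurry) :
    Continuous (Function.uncurry fun (p : X × ℝ) (y : ℝ) => u p.1 (p.2 + y) - u p.1 p.2) :=
  (hu.comp (by fun_prop : Continuous fun q : (X × ℝ) × ℝ => (q.1.1, q.1.2 + q.2))).sub
    (hu.comp (by fun_prop : Continuous fun q : (X × ℝ) × ℝ => (q.1.1, q.1.2)))

theorem continuous_increment_slice (hu : Continuous u.uncurry) (t : X) (x : ℝ) :
    Continuous fun y => u t (x + y) - u t x :=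
  (continuous_increment hu).comp (by fun_prop : Continuous fun y : ℝ => ((t, x), y))

variable [FirstCountableTopology X] [LocallyCompactSpace X] {a : ℝ}

/-- Dini-type statement: joint continuity of the full integral makes its tails near the origin
uniformly small on compact sets. -/
theorem exists_uniform_small_of_continuous (hu : Continuous u.uncurry)
    (hfin : ∀ p : X × ℝ,
      weightedSq a (Icc (-1) 1) (fun y => u p.1 (p.2 + y) - u p.1 p.2) ≠ ⊤)
    (hc : Continuous fun p : X × ℝ =>
      weightedSq a (Icc (-1) 1) (fun y => u p.1 (p.2 + y) - u p.1 p.2))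
    {K : Set (X × ℝ)} (hK : IsCompact K) {ε : ℝ≥0∞} (hε : 0 < ε) :
    ∃ δ : ℝ, 0 < δ ∧ δ ≤ 1 ∧
      ∀ p ∈ K, weightedSq a (Icc (-δ) δ) (fun y => u p.1 (p.2 + y) - u p.1 p.2) ≤ ε := by
  refine hK.induction_on (p := fun s => ∃ δ : ℝ, 0 < δ ∧ δ ≤ 1 ∧
      ∀ p ∈ s, weightedSq a (Icc (-δ) δ) (fun y => u p.1 (p.2 + y) - u p.1 p.2) ≤ ε)
    ⟨1, one_pos, le_rfl, by simp⟩ ?_ ?_ ?_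
  · rintro s t hst ⟨δ, h0, h1, h⟩
    exact ⟨δ, h0, h1, fun p hp => h p (hst hp)⟩
  · rintro s t ⟨δ, h0, h1, h⟩ ⟨δ', h0', h1', h'⟩
    refine ⟨min δ δ', lt_min h0 h0', (min_le_left _ _).trans h1, ?_⟩
    rintro p (hp | hp)
    · exact (weightedSq_mono (Icc_subset_Icc (neg_le_neg (min_le_left _ _))
        (min_le_left _ _)) _).trans (h p hp)
    · exact (weightedSq_mono (Icc_subset_Icc (neg_le_neg (min_le_right _ _))
        (min_le_right _ _)) _).trans (h' p hp)
  · intro p _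
    obtain ⟨δ, h0, h1, h⟩ := exists_weightedSq_Icc_lt (hfin p) hε
    have hann := continuous_weightedSq_annulus (a := a) h0 (continuous_increment hu)
    have heq (q : X × ℝ) :
        weightedSq a (Icc (-1) 1) (fun y => u q.1 (q.2 + y) - u q.1 q.2) -
          weightedSq a (Icc (-1) 1 \ Ioo (-δ) δ) (fun y => u q.1 (q.2 + y) - u q.1 q.2) =
        weightedSq a (Icc (-δ) δ) (fun y => u q.1 (q.2 + y) - u q.1 q.2) := by
      rw [weightedSq_split h1, ENNReal.add_sub_cancel_right
        (weightedSq_annulus_ne_top h0 (continuous_increment_slice hu q.1 q.2))]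
    have ht := ENNReal.Tendsto.sub (hc.tendsto p) (hann.tendsto p) (Or.inl (hfin p))
    simp only [heq] at ht
    exact ⟨_, mem_nhdsWithin_of_mem_nhds (ht.eventually_lt_const h), δ, h0, h1,
      fun q hq => le_of_lt hq⟩

theorem continuous_of_uniform_small (hu : Continuous u.uncurry)
    (hsmall : ∀ p : X × ℝ, ∀ ε > (0 : ℝ≥0∞), ∃ δ : ℝ, 0 < δ ∧ δ ≤ 1 ∧ ∀ᶠ q in nhds p,
      weightedSq a (Icc (-δ) δ) (fun y => u q.1 (q.2 + y) - u q.1 q.2) ≤ ε)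
    (hfin : ∀ p : X × ℝ,
      weightedSq a (Icc (-1) 1) (fun y => u p.1 (p.2 + y) - u p.1 p.2) ≠ ⊤) :
    Continuous fun p : X × ℝ =>
      weightedSq a (Icc (-1) 1) (fun y => u p.1 (p.2 + y) - u p.1 p.2) := by
  refine continuous_iff_continuousAt.2 fun p => ?_
  refine (ENNReal.tendsto_nhds (hfin p)).2 fun ε hε => ?_
  have hε2 : 0 < ε / 2 := ENNReal.half_pos hε.ne'
  obtain ⟨δ, h0, h1, h⟩ := hsmall p (ε / 2) hε2
  have hann := continuous_weightedSq_annulus (a := a) h0 (continuous_increment hu)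
  filter_upwards [h, (ENNReal.tendsto_nhds (weightedSq_annulus_ne_top h0
    (continuous_increment_slice hu p.1 p.2))).1 (hann.tendsto p) _ hε2] with q hq hq'
  have hp := h.self_of_nhds
  have key {A B A' B' : ℝ≥0∞} (hA : A ≤ ε / 2) (hB : B ≤ B' + ε / 2) :
      A + B ≤ A' + B' + ε :=
    calc A + B ≤ ε / 2 + (B' + ε / 2) := add_le_add hA hB
      _ = B' + ε := by rw [add_left_comm, ENNReal.add_halves]
      _ ≤ A' + B' + ε := by
        gcongr
        exact le_add_self
  rw [mem_Icc, tsub_le_iff_right, weightedSq_split h1, weightedSq_split h1]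
  exact ⟨key hp (tsub_le_iff_right.1 hq'.1), key hq hq'.2⟩

/-- Continuity of translations follows from uniform smallness near the origin. -/
theorem eventually_translate_small [CompactSpace X] (hu : Continuous u.uncurry)
    (hsmall : ∀ R > (0 : ℝ), ∀ ε > (0 : ℝ≥0∞), ∃ δ : ℝ, 0 < δ ∧ δ ≤ 1 ∧
      ∀ t : X, ∀ x ∈ Icc (-R) R,
        weightedSq a (Icc (-δ) δ) (fun y => u t (x + y) - u t x) ≤ ε)
    {R : ℝ} (hR : 0 < R) {ε : ℝ≥0∞} (hε : 0 < ε) :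
    ∀ᶠ h in nhds (0 : ℝ), ∀ t : X, ∀ x ∈ Icc (-R) R,
      weightedSq a (Icc (-1) 1)
        (fun y => u t (x + y - h) - u t (x + y) - (u t (x - h) - u t x)) ≤ ε := by
  have hε8 : 0 < ε / 8 := ENNReal.div_pos hε.ne' (by simp)
  obtain ⟨δ, h0, h1, hδ⟩ := hsmall (R + 1) (by linarith) (ε / 8) hε8
  set G : ℝ × (X × ℝ) → ℝ → ℝ := fun q y => u q.2.1 (q.2.2 + y - q.1) - u q.2.1 (q.2.2 + y) -
    (u q.2.1 (q.2.2 - q.1) - u q.2.1 q.2.2) with hGdef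
  have hG : Continuous G.uncurry :=
    ((hu.comp (by fun_prop : Continuous fun q : (ℝ × (X × ℝ)) × ℝ =>
        (q.1.2.1, q.1.2.2 + q.2 - q.1.1))).sub
      (hu.comp (by fun_prop : Continuous fun q : (ℝ × (X × ℝ)) × ℝ =>
        (q.1.2.1, q.1.2.2 + q.2)))).sub
    ((hu.comp (by fun_prop : Continuous fun q : (ℝ × (X × ℝ)) × ℝ =>
        (q.1.2.1, q.1.2.2 - q.1.1))).sub
      (hu.comp (by fun_prop : Continuous fun q : (ℝ × (X × ℝ)) × ℝ => (q.1.2.1, q.1.2.2))))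
  have hann := continuous_weightedSq_annulus (a := a) h0 hG
  have hK : IsCompact ((univ : Set X) ×ˢ Icc (-R) R) := isCompact_univ.prod isCompact_Icc
  have houter : ∀ᶠ h in nhds (0 : ℝ), ∀ p ∈ (univ : Set X) ×ˢ Icc (-R) R,
      weightedSq a (Icc (-1) 1 \ Ioo (-δ) δ) (G (h, p)) < ε / 8 := by
    refine hK.eventually_forall_of_forall_eventually fun p _ =>
      (hann.tendsto (0, p)).eventually_lt_const ?_
    have : G (0, p) = fun _ => 0 := by
      funext y
      simp [hGdef]
    simpa [this, weightedSq] using hε8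
  have hh : ∀ᶠ h in nhds (0 : ℝ), |h| < 1 :=
    continuous_abs.continuousAt.eventually_lt_const (by simp)
  filter_upwards [houter, hh] with h hout hh t x hx
  obtain ⟨hl, hr⟩ := abs_lt.1 hh
  have hinner : weightedSq a (Icc (-δ) δ) (G (h, (t, x))) ≤ 2 * (ε / 8 + ε / 8) := by
    have heq : G (h, (t, x)) =
        fun y => (u t (x - h + y) - u t (x - h)) - (u t (x + y) - u t x) := by
      funext y
      simp only [hGdef, show x + y - h = x - h + y by ring]
      ring
    rw [heq]
    refine (weightedSq_sub_le _ (continuous_increment_slice hu t (x - h))).trans ?_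
    gcongr
    · exact hδ t (x - h) ⟨by linarith [hx.1], by linarith [hx.2]⟩
    · exact hδ t x ⟨by linarith [hx.1], by linarith [hx.2]⟩
  change weightedSq a (Icc (-1) 1) (G (h, (t, x))) ≤ ε
  rw [weightedSq_split h1]
  calc _ ≤ 2 * (ε / 8 + ε / 8) + ε / 8 := add_le_add hinner (hout (t, x) ⟨trivial, hx⟩).le
    _ = 5 * (ε / 8) := by ring
    _ ≤ 8 * (ε / 8) := by gcongr; norm_num
    _ = ε := ENNReal.mul_div_cancel (by simp) (by simp)

end Increments

theorem NN_eq_weightedSq (β δ : ℝ) (f : ℝ → ℝ → ℝ) (t x : ℝ) :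
    NN β δ f t x = weightedSq (-1 - 2 * β) (Icc (-δ) δ) (fun y => f t (x + y) - f t x) ^
      (1 / 2 : ℝ) :=
  rfl

/-- The uniform limit condition, spelled out with `ε` and `δ`. -/
theorem tendsto_iSup_weightedSq_iff {X : Type*} {a R : ℝ} {u : X → ℝ → ℝ} :
    Tendsto (fun δ : ℝ => ⨆ (t : X) (x : Icc (-R) R),
        weightedSq a (Icc (-δ) δ) (fun y => u t (x.1 + y) - u t x.1))
      (nhdsWithin 0 (Ioi 0)) (nhds 0) ↔
    ∀ ε > (0 : ℝ≥0∞), ∃ δ : ℝ, 0 < δ ∧ δ ≤ 1 ∧ ∀ t : X, ∀ x ∈ Icc (-R) R,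
      weightedSq a (Icc (-δ) δ) (fun y => u t (x + y) - u t x) ≤ ε := by
  simp only [ENNReal.tendsto_nhds_zero, iSup_le_iff, Subtype.forall]
  refine forall₂_congr fun ε _ => ⟨fun h => ?_, ?_⟩
  · obtain ⟨δ, hδ, h0, h1⟩ := (h.and (Ioc_mem_nhdsGT one_pos)).exists
    exact ⟨δ, h0, h1, hδ⟩
  · rintro ⟨δ, h0, -, h⟩
    filter_upwards [Ioc_mem_nhdsGT h0] with d hd t x hx
    exact (weightedSq_mono (Icc_subset_Icc (neg_le_neg hd.2) hd.2) _).trans (h t x hx)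

theorem continuousOn_prod_univ_of_continuous {s : Set ℝ} {φ : ℝ × ℝ → ℝ}
    (h : Continuous fun p : s × ℝ => φ (p.1, p.2)) : ContinuousOn φ (s ×ˢ univ) := by
  have hmap : Continuous fun q : (s ×ˢ (univ : Set ℝ) : Set (ℝ × ℝ)) =>
      ((⟨q.1.1, q.2.1⟩, q.1.2) : s × ℝ) :=
    (Continuous.subtype_mk (by fun_prop) _).prodMk (by fun_prop)
  exact continuousOn_iff_continuous_domRestrict.2 (h.comp hmap)

/-- Characterization of `X^β_T`: for a continuous `f` such that `t ↦ 𝒩_β^{(1)} f(t,x)` is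
finite and continuous for each fixed `x`, one has `f ∈ X^β_T` if and only if for every `R > 0`,
`lim_{δ ↓ 0} sup_{t ∈ [0,T], x ∈ [-R,R]} ∫_{|y| ≤ δ} |f(t,x+y) - f(t,x)|² |y|^{-2β-1} dy = 0`. -/
theorem stmt_7 (β T : ℝ) (hβ : β ∈ Set.Ioo (0:ℝ) 1) (hT : 0 < T)
    (f : ℝ → ℝ → ℝ)
    (hcont : ContinuousOn (fun p : ℝ × ℝ => f p.1 p.2)
      (Set.Icc (0:ℝ) T ×ˢ (Set.univ : Set ℝ)))
    (hfin : ∀ x : ℝ, ∀ t ∈ Set.Icc (0:ℝ) T, NN β 1 f t x ≠ ⊤)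
    (htcont : ∀ x : ℝ, ContinuousOn (fun t => (NN β 1 f t x).toReal) (Set.Icc (0:ℝ) T)) :
    memX β T f ↔
      ∀ R > (0:ℝ), Filter.Tendsto
        (fun δ : ℝ => ⨆ (t : Set.Icc (0:ℝ) T) (x : Set.Icc (-R) R),
          ∫⁻ y in Set.Icc (-δ) δ,
            ENNReal.ofReal (|f t.1 (x.1 + y) - f t.1 x.1| ^ 2 * |y| ^ (-2 * β - 1)))
        (nhdsWithin 0 (Set.Ioi 0)) (nhds (0 : ℝ≥0∞)) := by
  set u : Icc (0:ℝ) T → ℝ → ℝ := fun t x => f t x with hudef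
  have hu : Continuous u.uncurry :=
    hcont.comp_continuous (f := fun p : Icc (0:ℝ) T × ℝ => (p.1.1, p.2)) (by fun_prop)
      fun p => ⟨p.1.2, trivial⟩
  have hfinu (p : Icc (0:ℝ) T × ℝ) : weightedSq (-1 - 2 * β) (Icc (-1) 1)
      (fun y => u p.1 (p.2 + y) - u p.1 p.2) ≠ ⊤ := by
    intro h
    refine hfin p.2 p.1 p.1.2 ?_
    rw [NN_eq_weightedSq]
    change weightedSq (-1 - 2 * β) (Icc (-1) 1)
      (fun y => u p.1 (p.2 + y) - u p.1 p.2) ^ (1 / 2 : ℝ) = ⊤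
    rw [h, ENNReal.top_rpow_of_pos (by norm_num)]
  rw [show -2 * β - 1 = -1 - 2 * β by ring]
  have hiff : (∀ R > (0:ℝ), Tendsto
        (fun δ : ℝ => ⨆ (t : Icc (0:ℝ) T) (x : Icc (-R) R),
          ∫⁻ y in Icc (-δ) δ,
            ENNReal.ofReal (|f t.1 (x.1 + y) - f t.1 x.1| ^ 2 * |y| ^ (-1 - 2 * β)))
        (nhdsWithin 0 (Ioi 0)) (nhds (0 : ℝ≥0∞))) ↔ _ :=
    forall₂_congr fun R _ => tendsto_iSup_weightedSq_iff (a := -1 - 2 * β) (R := R) (u := u)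
  rw [hiff]
  constructor
  · rintro ⟨-, -, hNN, -⟩ R _ ε hε
    have hN : Continuous fun p : Icc (0:ℝ) T × ℝ => (NN β 1 f p.1 p.2).toReal :=
      hNN.comp_continuous (f := fun p : Icc (0:ℝ) T × ℝ => (p.1.1, p.2)) (by fun_prop)
        fun p => ⟨p.1.2, trivial⟩
    have hc : Continuous fun p : Icc (0:ℝ) T × ℝ => weightedSq (-1 - 2 * β) (Icc (-1) 1)
        (fun y => u p.1 (p.2 + y) - u p.1 p.2) := by
      refine ((ENNReal.continuous_rpow_const (y := 2)).comp
        (ENNReal.continuous_ofReal.comp hN)).congr fun p => ?_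
      simp only [Function.comp_apply]
      rw [ENNReal.ofReal_toReal (hfin _ _ p.1.2), NN_eq_weightedSq, ← ENNReal.rpow_mul]
      norm_num [hudef]
    obtain ⟨δ, h0, h1, h⟩ := exists_uniform_small_of_continuous hu hfinu hc
      (isCompact_univ.prod (isCompact_Icc (a := -R) (b := R))) hε
    exact ⟨δ, h0, h1, fun t x hx => h (t, x) ⟨trivial, hx⟩⟩
  · intro hsmall
    refine ⟨hcont, fun t ht x => hfin x t ht, ?_, fun R hR => ?_⟩
    · have hc := continuous_of_uniform_small hu (fun p ε hε => ?_) hfinu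
      · have hN : Continuous fun p : Icc (0:ℝ) T × ℝ => NN β 1 f p.1 p.2 :=
          ENNReal.continuous_rpow_const.comp hc
        exact continuousOn_prod_univ_of_continuous (continuous_iff_continuousAt.2 fun p =>
          (ENNReal.tendsto_toReal (hfin _ _ p.1.2)).comp (hN.tendsto p))
      · obtain ⟨δ, h0, h1, h⟩ := hsmall (|p.2| + 1) (by positivity) ε hε
        refine ⟨δ, h0, h1, ?_⟩
        have hev : ∀ᶠ q : Icc (0:ℝ) T × ℝ in nhds p, |q.2| < |p.2| + 1 :=
          (by fun_prop : Continuous fun q : Icc (0:ℝ) T × ℝ => |q.2|).continuousAt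
            |>.eventually_lt_const (by simp)
        filter_upwards [hev] with q hq
        exact h q.1 q.2 (abs_le.1 hq.le)
    · rw [ENNReal.tendsto_nhds_zero]
      intro ε hε
      filter_upwards [eventually_translate_small hu hsmall hR
        (show 0 < ε ^ (2 : ℝ) from ENNReal.rpow_pos_of_nonneg hε (by norm_num))] with h hh
      refine iSup_le fun t => iSup_le fun x => ?_
      rw [NN_eq_weightedSq, one_div, ENNReal.rpow_inv_le_iff (by norm_num)]
      exact hh t x.1 x.2
end

section
/- Let β ∈ (0,1), T > 0, let σ : ℝ → ℝ be a Lipschitz function, and let f ∈ X^β_T. Suppose that for every fixed x ∈ ℝ, the map t ↦ 𝒩_β^{(1)}(σ∘f)(t,x) is continuous on [0,T]. Then σ∘f belongs to X^β_T. Furthermore, if (f_n) is a sequence converging to f in X^β_T, then for every R > 0 and every δ > 0, lim_{n→∞} sup_{t∈[0,T], |x|≤R} 𝒩_β^{(δ)}(σ∘f_n − σ∘f)(t,x) = 0. -/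
open MeasureTheory Set Filter
open scoped ENNReal

/-- The square of the truncated seminorm, with the integral taken over an arbitrary set `A`. -/
noncomputable def sqNN (β : ℝ) (A : Set ℝ) (f : ℝ → ℝ → ℝ) (t x : ℝ) : ℝ≥0∞ :=
  ∫⁻ h in A, ENNReal.ofReal (|f t (x + h) - f t x| ^ 2 * |h| ^ (-1 - 2 * β))

lemma NN_eq_sqNN_rpow (β δ : ℝ) (f : ℝ → ℝ → ℝ) (t x : ℝ) :
    NN β δ f t x = sqNN β (Icc (-δ) δ) f t x ^ (1/2 : ℝ) := rfl

lemma sqNN_le_of_NN_le {β δ : ℝ} {f : ℝ → ℝ → ℝ} {t x η : ℝ} (hη : 0 ≤ η)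
    (h : NN β δ f t x ≤ ENNReal.ofReal η) :
    sqNN β (Icc (-δ) δ) f t x ≤ ENNReal.ofReal (η ^ 2) := by
  rw [NN_eq_sqNN_rpow] at h
  have h2 := ENNReal.rpow_le_rpow h (zero_le_two : (0:ℝ) ≤ 2)
  rw [← ENNReal.rpow_mul, ENNReal.ofReal_rpow_of_nonneg hη zero_le_two] at h2
  norm_num at h2
  exact h2

lemma NN_le_of_sqNN_le {β δ : ℝ} {f : ℝ → ℝ → ℝ} {t x η : ℝ} (hη : 0 ≤ η)
    (h : sqNN β (Icc (-δ) δ) f t x ≤ ENNReal.ofReal (η ^ 2)) :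
    NN β δ f t x ≤ ENNReal.ofReal η := by
  rw [NN_eq_sqNN_rpow]
  refine (ENNReal.rpow_le_rpow h (by norm_num)).trans_eq ?_
  rw [ENNReal.ofReal_rpow_of_nonneg (sq_nonneg η) (by norm_num), ← Real.sqrt_eq_rpow,
    Real.sqrt_sq hη]

lemma sqNN_Icc_ne_top {β δ : ℝ} {f : ℝ → ℝ → ℝ} {t x : ℝ} (h : NN β δ f t x ≠ ⊤) :
    sqNN β (Icc (-δ) δ) f t x ≠ ⊤ := by
  intro h'
  rw [NN_eq_sqNN_rpow, h'] at h
  exact h (ENNReal.top_rpow_of_pos (by norm_num))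

lemma sqNN_mono_set {β : ℝ} {A B : Set ℝ} (hAB : A ⊆ B) (f : ℝ → ℝ → ℝ) (t x : ℝ) :
    sqNN β A f t x ≤ sqNN β B f t x :=
  lintegral_mono_set hAB

lemma sqNN_Icc_add_diff (β ε δ : ℝ) (hεδ : ε ≤ δ) (f : ℝ → ℝ → ℝ) (t x : ℝ) :
    sqNN β (Icc (-ε) ε) f t x + sqNN β (Icc (-δ) δ \ Icc (-ε) ε) f t x
      = sqNN β (Icc (-δ) δ) f t x := by
  have h := lintegral_inter_add_sdiff (μ := volume)
    (fun h => ENNReal.ofReal (|f t (x + h) - f t x| ^ 2 * |h| ^ (-1 - 2 * β)))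
    (Icc (-δ) δ) (measurableSet_Icc (a := -ε) (b := ε))
  rwa [inter_eq_right.2 (Icc_subset_Icc (neg_le_neg hεδ) hεδ)] at h

lemma sqNN_comp_le {σ : ℝ → ℝ} {K : NNReal} (hσ : LipschitzWith K σ) (β : ℝ) (A : Set ℝ)
    (f : ℝ → ℝ → ℝ) (t x : ℝ) :
    sqNN β A (fun t x => σ (f t x)) t x ≤ ENNReal.ofReal ((K:ℝ) ^ 2) * sqNN β A f t x := by
  rw [sqNN, sqNN, ← lintegral_const_mul' _ _ ENNReal.ofReal_ne_top]
  refine lintegral_mono fun h => ?_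
  rw [← ENNReal.ofReal_mul (by positivity)]
  refine ENNReal.ofReal_le_ofReal ?_
  have h1 : |σ (f t (x + h)) - σ (f t x)| ≤ K * |f t (x + h) - f t x| := by
    simpa [Real.dist_eq] using hσ.dist_le_mul (f t (x + h)) (f t x)
  rw [← mul_assoc, ← mul_pow]
  gcongr

/-- Away from the origin the weight `|h|^{-1-2β}` is bounded. -/
lemma weight_le {β ε δ h : ℝ} (hβ : 0 < β) (hε : 0 < ε) (hh : h ∈ Icc (-δ) δ \ Icc (-ε) ε) :
    |h| ^ (-1 - 2 * β) ≤ ε ^ (-1 - 2 * β) := by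
  have h1 : ε ≤ |h| := by
    by_contra! hlt
    exact hh.2 (abs_le.1 hlt.le)
  exact Real.rpow_le_rpow_of_nonpos hε h1 (by linarith)

lemma volume_Icc_diff_lt_top (δ ε : ℝ) : volume (Icc (-δ) δ \ Icc (-ε) ε) < ⊤ :=
  (measure_mono sdiff_subset).trans_lt measure_Icc_lt_top

/-- A bound on the oscillation of `f` bounds the part of the seminorm away from the origin. -/
lemma sqNN_diff_le {β ε δ M : ℝ} (hβ : 0 < β) (hε : 0 < ε) {f : ℝ → ℝ → ℝ} {t x : ℝ}
    (hM : ∀ h ∈ Icc (-δ) δ, |f t (x + h) - f t x| ≤ M) :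
    sqNN β (Icc (-δ) δ \ Icc (-ε) ε) f t x ≤
      ENNReal.ofReal (M ^ 2 * (ε ^ (-1 - 2 * β) * volume.real (Icc (-δ) δ \ Icc (-ε) ε))) := by
  have hmeas : MeasurableSet (Icc (-δ) δ \ Icc (-ε) ε) := measurableSet_Icc.diff measurableSet_Icc
  have h1 : sqNN β (Icc (-δ) δ \ Icc (-ε) ε) f t x ≤
      ∫⁻ _ in Icc (-δ) δ \ Icc (-ε) ε, ENNReal.ofReal (M ^ 2 * ε ^ (-1 - 2 * β)) := by
    refine setLIntegral_mono' hmeas fun h hh => ENNReal.ofReal_le_ofReal ?_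
    have := hM h hh.1
    have := weight_le hβ hε hh
    gcongr
  refine h1.trans_eq ?_
  rw [setLIntegral_const, ← mul_assoc, ENNReal.ofReal_mul (by positivity : 0 ≤ M ^ 2 * _),
    ofReal_measureReal (volume_Icc_diff_lt_top δ ε).ne]

lemma continuous_slice {T : ℝ} {f : ℝ → ℝ → ℝ}
    (hf : ContinuousOn (fun p : ℝ × ℝ => f p.1 p.2) (Icc (0:ℝ) T ×ˢ univ))
    {t : ℝ} (ht : t ∈ Icc (0:ℝ) T) : Continuous (f t) := by
  have : ContinuousOn (fun x : ℝ => f t x) univ :=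
    hf.comp (f := fun x : ℝ => (t, x)) (by fun_prop) fun x _ => ⟨ht, mem_univ _⟩
  exact continuousOn_univ.1 this

lemma measurable_integrand (β : ℝ) {g : ℝ → ℝ} (hg : Continuous g) (x : ℝ) :
    Measurable fun h : ℝ => ENNReal.ofReal (|g (x + h) - g x| ^ 2 * |h| ^ (-1 - 2 * β)) := by
  have : Measurable g := hg.measurable
  fun_prop

lemma exists_abs_le_of_continuousOn {T : ℝ} {f : ℝ → ℝ → ℝ}
    (hf : ContinuousOn (fun p : ℝ × ℝ => f p.1 p.2) (Icc (0:ℝ) T ×ˢ univ)) (R : ℝ) :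
    ∃ M, ∀ t ∈ Icc (0:ℝ) T, ∀ x ∈ Icc (-R) R, |f t x| ≤ M := by
  obtain ⟨M, hM⟩ := (isCompact_Icc.prod isCompact_Icc).exists_bound_of_continuousOn
    (hf.mono (prod_mono_right (subset_univ (Icc (-R) R))))
  exact ⟨M, fun t ht x hx => hM (t, x) ⟨ht, hx⟩⟩

/-- The part of the squared seminorm away from the origin depends continuously on the point. -/
lemma continuousOn_sqNN_diff {β T ε δ : ℝ} (hβ : 0 < β) (hε : 0 < ε) {f : ℝ → ℝ → ℝ}
    (hf : ContinuousOn (fun p : ℝ × ℝ => f p.1 p.2) (Icc (0:ℝ) T ×ˢ univ)) :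
    ContinuousOn (fun p : ℝ × ℝ => sqNN β (Icc (-δ) δ \ Icc (-ε) ε) f p.1 p.2)
      (Icc (0:ℝ) T ×ˢ univ) := by
  have hmeas : MeasurableSet (Icc (-δ) δ \ Icc (-ε) ε) := measurableSet_Icc.diff measurableSet_Icc
  rintro ⟨t₀, x₀⟩ hp₀
  obtain ⟨M, hM⟩ := exists_abs_le_of_continuousOn hf (|x₀| + 1 + |δ|)
  have hnear : ∀ᶠ p : ℝ × ℝ in nhdsWithin (t₀, x₀) (Icc (0:ℝ) T ×ˢ univ),
      p.1 ∈ Icc (0:ℝ) T ∧ |p.2| < |x₀| + 1 := by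
    have h1 : ∀ᶠ p : ℝ × ℝ in nhds (t₀, x₀), |p.2| < |x₀| + 1 :=
      (continuous_abs.comp continuous_snd).continuousAt.eventually_lt_const
        (by simp)
    filter_upwards [nhdsWithin_le_nhds h1, self_mem_nhdsWithin] with p hp hp'
    exact ⟨hp'.1, hp⟩
  refine tendsto_lintegral_filter_of_dominated_convergence
    (fun _ => ENNReal.ofReal ((M + M) ^ 2 * ε ^ (-1 - 2 * β))) ?_ ?_ ?_ ?_
  · filter_upwards [hnear] with p hp
    exact (measurable_integrand β (continuous_slice hf hp.1) p.2)
  · filter_upwards [hnear] with p hp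
    refine (ae_restrict_iff' hmeas).2 (ae_of_all _ fun h hh => ENNReal.ofReal_le_ofReal ?_)
    have h0 : |h| ≤ |δ| := (abs_le.2 hh.1).trans (le_abs_self δ)
    have h1 := hM p.1 hp.1 p.2 (abs_le.1 (by linarith [abs_nonneg δ]))
    have h2 := hM p.1 hp.1 (p.2 + h) (abs_le.1 (by linarith [abs_add_le p.2 h]))
    have h3 : |f p.1 (p.2 + h) - f p.1 p.2| ≤ M + M :=
      (abs_sub _ _).trans (add_le_add h2 h1)
    have := weight_le hβ hε hh
    gcongr
  · rw [setLIntegral_const]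
    exact ENNReal.mul_ne_top ENNReal.ofReal_ne_top (volume_Icc_diff_lt_top δ ε).ne
  · refine ae_of_all _ fun h => ENNReal.tendsto_ofReal (Tendsto.mul_const _ ?_)
    have h1 : ContinuousOn (fun p : ℝ × ℝ => f p.1 (p.2 + h)) (Icc (0:ℝ) T ×ˢ univ) :=
      hf.comp (f := fun p : ℝ × ℝ => (p.1, p.2 + h)) (by fun_prop) fun p hp => ⟨hp.1, mem_univ _⟩
    exact ((h1.sub hf).abs.pow 2) _ hp₀

/-- A Dini-type argument: continuity of the seminorm forces its part near the origin to be
locally uniformly small. -/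
lemma exists_sqNN_le {β T : ℝ} (hβ : 0 < β) {f : ℝ → ℝ → ℝ} (hf : memX β T f) (R : ℝ)
    {η : ℝ≥0∞} (hη : 0 < η) :
    ∃ ε, 0 < ε ∧ ε ≤ 1 ∧ ∀ t ∈ Icc (0:ℝ) T, ∀ x ∈ Icc (-R) R, sqNN β (Icc (-ε) ε) f t x ≤ η := by
  obtain ⟨hcont, hfin, hNN, -⟩ := hf
  suffices H : ∃ ε, 0 < ε ∧ ε ≤ 1 ∧ ∀ p ∈ Icc (0:ℝ) T ×ˢ Icc (-R) R,
      sqNN β (Icc (-ε) ε) f p.1 p.2 ≤ η by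
    obtain ⟨ε, h0, h1, h⟩ := H
    exact ⟨ε, h0, h1, fun t ht x hx => h (t, x) ⟨ht, hx⟩⟩
  refine (isCompact_Icc.prod isCompact_Icc).induction_on
    (p := fun s => ∃ ε, 0 < ε ∧ ε ≤ 1 ∧ ∀ p ∈ s, sqNN β (Icc (-ε) ε) f p.1 p.2 ≤ η)
    ⟨1, one_pos, le_rfl, by simp⟩ ?_ ?_ ?_
  · rintro s s' hss ⟨ε, h0, h1, h⟩
    exact ⟨ε, h0, h1, fun p hp => h p (hss hp)⟩
  · rintro s s' ⟨ε, h0, h1, h⟩ ⟨ε', h0', h1', h'⟩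
    refine ⟨min ε ε', lt_min h0 h0', (min_le_left _ _).trans h1, ?_⟩
    rintro p (hp | hp)
    · exact (sqNN_mono_set (Icc_subset_Icc (neg_le_neg (min_le_left _ _)) (min_le_left _ _))
        f _ _).trans (h p hp)
    · exact (sqNN_mono_set (Icc_subset_Icc (neg_le_neg (min_le_right _ _)) (min_le_right _ _))
        f _ _).trans (h' p hp)
  · rintro ⟨t₀, x₀⟩ ⟨ht₀, -⟩
    have hp₀ : (t₀, x₀) ∈ Icc (0:ℝ) T ×ˢ (univ : Set ℝ) := ⟨ht₀, mem_univ _⟩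
    obtain ⟨ε, hε0, hε1, hε⟩ : ∃ ε, 0 < ε ∧ ε ≤ 1 ∧ sqNN β (Icc (-ε) ε) f t₀ x₀ < η := by
      have hvol : Tendsto ((volume.restrict (Icc (-1:ℝ) 1)) ∘ fun ε : ℝ => Icc (-ε) ε)
          (nhdsWithin 0 (Ioi 0)) (nhds 0) := by
        have h1 : Tendsto (fun ε : ℝ => ENNReal.ofReal (ε - -ε)) (nhdsWithin 0 (Ioi 0))
            (nhds 0) := by
          have : Continuous fun ε : ℝ => ENNReal.ofReal (ε - -ε) :=
            ENNReal.continuous_ofReal.comp (by fun_prop)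
          simpa using (this.tendsto 0).mono_left nhdsWithin_le_nhds
        refine tendsto_of_tendsto_of_tendsto_of_le_of_le tendsto_const_nhds h1
          (fun _ => zero_le) fun ε => ?_
        exact (Measure.restrict_apply_le _ _).trans_eq Real.volume_Icc
      have h2 := tendsto_setLIntegral_zero (sqNN_Icc_ne_top (hfin t₀ ht₀ x₀)) hvol
      obtain ⟨ε, hlt, hpos, hle⟩ := ((h2.eventually_lt_const hη).and
        (Ioc_mem_nhdsGT (zero_lt_one' ℝ))).exists
      refine ⟨ε, hpos, hle, ?_⟩
      rwa [Measure.restrict_restrict measurableSet_Icc,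
        inter_eq_left.2 (Icc_subset_Icc (neg_le_neg hle) hle)] at hlt
    have hfin' : ∀ p ∈ Icc (0:ℝ) T ×ˢ (univ : Set ℝ),
        sqNN β (Icc (-1) 1 \ Icc (-ε) ε) f p.1 p.2 ≠ ⊤ := fun p hp =>
      ne_top_of_le_ne_top (sqNN_Icc_ne_top (hfin p.1 hp.1 p.2)) (sqNN_mono_set sdiff_subset f _ _)
    have hfull : ContinuousOn (fun p : ℝ × ℝ => sqNN β (Icc (-1) 1) f p.1 p.2)
        (Icc (0:ℝ) T ×ˢ univ) := by
      refine (ENNReal.continuous_ofReal.comp_continuousOn (hNN.pow 2)).congr fun p hp => ?_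
      have h := hfin p.1 hp.1 p.2
      simp only [Function.comp_apply, Pi.pow_apply, ← ENNReal.toReal_pow]
      rw [ENNReal.ofReal_toReal (ENNReal.pow_ne_top h), NN_eq_sqNN_rpow, ← ENNReal.rpow_natCast,
        ← ENNReal.rpow_mul]
      norm_num
    have hsub : Tendsto (fun p : ℝ × ℝ => sqNN β (Icc (-1) 1) f p.1 p.2
        - sqNN β (Icc (-1) 1 \ Icc (-ε) ε) f p.1 p.2)
        (nhdsWithin (t₀, x₀) (Icc (0:ℝ) T ×ˢ univ)) (nhds (sqNN β (Icc (-ε) ε) f t₀ x₀)) := by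
      have h := ENNReal.Tendsto.sub (hfull _ hp₀)
        (continuousOn_sqNN_diff (δ := 1) hβ hε0 hcont _ hp₀) (Or.inr (hfin' _ hp₀))
      convert h using 2
      simp only []
      rw [← sqNN_Icc_add_diff β ε 1 hε1, ENNReal.add_sub_cancel_right (hfin' _ hp₀)]
    have hev := hsub.eventually_lt_const hε
    refine ⟨_, nhdsWithin_mono _ (prod_mono_right (subset_univ _))
      (inter_mem hev self_mem_nhdsWithin), ε, hε0, hε1, ?_⟩
    rintro p ⟨hlt, hp⟩
    rw [mem_ofPred_eq, ← sqNN_Icc_add_diff β ε 1 hε1,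
      ENNReal.add_sub_cancel_right (hfin' _ hp)] at hlt
    exact hlt.le

lemma sqNN_comp_sub_comp_le {σ : ℝ → ℝ} {K : NNReal} (hσ : LipschitzWith K σ) (β : ℝ)
    (A : Set ℝ) {f g : ℝ → ℝ → ℝ} {t : ℝ} (hf : Continuous (f t)) (x : ℝ) :
    sqNN β A (fun t x => σ (g t x) - σ (f t x)) t x ≤
      ENNReal.ofReal (2 * (K:ℝ) ^ 2) * sqNN β A (fun t x => g t x - f t x) t x +
      ENNReal.ofReal (8 * (K:ℝ) ^ 2) * sqNN β A f t x := by
  rw [sqNN, sqNN, sqNN, ← lintegral_const_mul' _ _ ENNReal.ofReal_ne_top,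
    ← lintegral_const_mul' _ _ ENNReal.ofReal_ne_top,
    ← lintegral_add_right _ ((measurable_integrand β hf x).const_mul _)]
  refine lintegral_mono fun h => ?_
  simp only []
  rw [← ENNReal.ofReal_mul (by positivity), ← ENNReal.ofReal_mul (by positivity),
    ← ENNReal.ofReal_add (by positivity) (by positivity)]
  refine ENNReal.ofReal_le_ofReal ?_
  have h1 : |σ (g t (x + h)) - σ (g t x)| ≤ K * |g t (x + h) - g t x| := by
    simpa [Real.dist_eq] using hσ.dist_le_mul (g t (x + h)) (g t x)
  have h2 : |σ (f t (x + h)) - σ (f t x)| ≤ K * |f t (x + h) - f t x| := by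
    simpa [Real.dist_eq] using hσ.dist_le_mul (f t (x + h)) (f t x)
  set a := |g t (x + h) - f t (x + h) - (g t x - f t x)| with ha
  set b := |f t (x + h) - f t x| with hb
  have h3 : |g t (x + h) - g t x| ≤ a + b := by
    have := abs_add_le (g t (x + h) - f t (x + h) - (g t x - f t x)) (f t (x + h) - f t x)
    rwa [show g t (x + h) - f t (x + h) - (g t x - f t x) + (f t (x + h) - f t x) =
      g t (x + h) - g t x by ring] at this
  have h4 : |σ (g t (x + h)) - σ (f t (x + h)) - (σ (g t x) - σ (f t x))| ≤ K * (a + 2 * b) := by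
    have h5 := abs_sub (σ (g t (x + h)) - σ (g t x)) (σ (f t (x + h)) - σ (f t x))
    have h6 : σ (g t (x + h)) - σ (f t (x + h)) - (σ (g t x) - σ (f t x)) =
      σ (g t (x + h)) - σ (g t x) - (σ (f t (x + h)) - σ (f t x)) := by ring
    rw [h6]
    have h7 := mul_le_mul_of_nonneg_left h3 K.2
    simp only [NNReal.val_eq_coe] at h7
    linarith
  rw [← mul_assoc, ← mul_assoc, ← add_mul]
  gcongr
  calc _ ≤ (K * (a + 2 * b)) ^ 2 := by gcongr
    _ = (K:ℝ) ^ 2 * (a + 2 * b) ^ 2 := by ring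
    _ ≤ (K:ℝ) ^ 2 * (2 * a ^ 2 + 8 * b ^ 2) := by
      gcongr
      nlinarith [sq_nonneg (a - 2 * b)]
    _ = _ := by ring

/-- Left composition with a Lipschitz function is sequentially continuous at points of `X^β_T`,
stated along an arbitrary filter. -/
lemma tendsto_iSup_NN_comp_sub {ι : Type*} {l : Filter ι} {β T : ℝ} (hβ : 0 < β)
    {σ : ℝ → ℝ} {K : NNReal} (hσ : LipschitzWith K σ) {f : ℝ → ℝ → ℝ} (hf : memX β T f)
    {g : ι → ℝ → ℝ → ℝ}
    (hg : ∀ R > (0:ℝ), ∀ ε > (0:ℝ), ∀ᶠ i in l, ∀ t ∈ Icc (0:ℝ) T, ∀ x ∈ Icc (-R) R,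
      |g i t x - f t x| ≤ ε ∧ NN β 1 (fun t x => g i t x - f t x) t x ≤ ENNReal.ofReal ε)
    {R δ : ℝ} (hR : 0 < R) (hδ : 0 < δ) :
    Tendsto (fun i => ⨆ (t : Icc (0:ℝ) T) (x : Icc (-R) R),
      NN β δ (fun t x => σ (g i t x) - σ (f t x)) t.1 x.1) l (nhds 0) := by
  rw [ENNReal.tendsto_nhds_zero]
  intro e he
  obtain ⟨c, hc0, hce⟩ : ∃ c : ℝ, 0 < c ∧ ENNReal.ofReal c ≤ e := by
    obtain ⟨r, hr0, hr⟩ := ENNReal.lt_iff_exists_nnreal_btwn.1 he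
    exact ⟨r, by exact_mod_cast hr0, by simpa using hr.le⟩
  obtain ⟨ε, hε0, hε1, hε⟩ := exists_sqNN_le hβ hf R
    (η := ENNReal.ofReal (c ^ 2 / 2 / (8 * (K:ℝ) ^ 2 + 1))) (by simp; positivity)
  set W := ε ^ (-1 - 2 * β) * volume.real (Icc (-δ) δ \ Icc (-ε) ε) with hW
  have hW0 : 0 ≤ W := by positivity
  set η := Real.sqrt (c ^ 2 / 2 / (2 * (K:ℝ) ^ 2 + 4 * (K:ℝ) ^ 2 * W + 1)) with hη
  have hη0 : 0 < η := Real.sqrt_pos.2 (by positivity)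
  have hη2 : 2 * (K:ℝ) ^ 2 * η ^ 2 + (2 * K * η) ^ 2 * W ≤ c ^ 2 / 2 := by
    have h1 : η ^ 2 * (2 * (K:ℝ) ^ 2 + 4 * (K:ℝ) ^ 2 * W + 1) = c ^ 2 / 2 := by
      rw [hη, Real.sq_sqrt (by positivity)]
      field_simp
    nlinarith [sq_nonneg η]
  have hK : 8 * (K:ℝ) ^ 2 * (c ^ 2 / 2 / (8 * (K:ℝ) ^ 2 + 1)) ≤ c ^ 2 / 2 := by
    rw [mul_div_assoc', div_le_iff₀ (by positivity)]
    nlinarith [sq_nonneg c]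
  filter_upwards [hg (R + δ) (by positivity) η hη0] with i hi
  refine iSup_le fun t => iSup_le fun x => le_trans (NN_le_of_sqNN_le hc0.le ?_) hce
  obtain ⟨t, ht⟩ := t
  obtain ⟨x, hx⟩ := x
  have hσgf : ∀ y ∈ Icc (-(R + δ)) (R + δ), |σ (g i t y) - σ (f t y)| ≤ K * η := fun y hy => by
    have h1 : |σ (g i t y) - σ (f t y)| ≤ K * |g i t y - f t y| := by
      simpa [Real.dist_eq] using hσ.dist_le_mul (g i t y) (f t y)
    exact h1.trans (mul_le_mul_of_nonneg_left (hi t ht y hy).1 K.2)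
  have hxR : x ∈ Icc (-(R + δ)) (R + δ) := ⟨by linarith [hx.1], by linarith [hx.2]⟩
  have hfar : sqNN β (Icc (-δ) δ \ Icc (-ε) ε) (fun t x => σ (g i t x) - σ (f t x)) t x ≤
      ENNReal.ofReal ((2 * K * η) ^ 2 * W) := by
    refine sqNN_diff_le hβ hε0 fun h hh => ?_
    have h1 := hσgf (x + h) ⟨by linarith [hx.1, hh.1], by linarith [hx.2, hh.2]⟩
    have h2 := hσgf x hxR
    have h3 := abs_sub (σ (g i t (x + h)) - σ (f t (x + h))) (σ (g i t x) - σ (f t x))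
    linarith
  have hnear : sqNN β (Icc (-ε) ε) (fun t x => σ (g i t x) - σ (f t x)) t x ≤
      ENNReal.ofReal (2 * (K:ℝ) ^ 2 * η ^ 2) + ENNReal.ofReal (c ^ 2 / 2) := by
    refine (sqNN_comp_sub_comp_le hσ β _ (continuous_slice hf.1 ht) x).trans (add_le_add ?_ ?_)
    · rw [ENNReal.ofReal_mul (by positivity : 0 ≤ 2 * (K:ℝ) ^ 2)]
      refine mul_le_mul_right ?_ _
      exact (sqNN_mono_set (Icc_subset_Icc (neg_le_neg hε1) hε1) _ _ _).trans
        (sqNN_le_of_NN_le hη0.le (hi t ht x hxR).2)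
    · refine le_trans ?_ (ENNReal.ofReal_le_ofReal hK)
      rw [ENNReal.ofReal_mul (by positivity : 0 ≤ 8 * (K:ℝ) ^ 2)]
      exact mul_le_mul_right (hε t ht x hx) _
  have hsplit : sqNN β (Icc (-δ) δ) (fun t x => σ (g i t x) - σ (f t x)) t x ≤
      sqNN β (Icc (-ε) ε) (fun t x => σ (g i t x) - σ (f t x)) t x +
      sqNN β (Icc (-δ) δ \ Icc (-ε) ε) (fun t x => σ (g i t x) - σ (f t x)) t x := by
    refine le_trans (lintegral_mono_set ?_) (lintegral_union_le _ _ _)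
    intro h hh
    by_cases h' : h ∈ Icc (-ε) ε
    · exact Or.inl h'
    · exact Or.inr ⟨hh, h'⟩
  refine hsplit.trans ((add_le_add hnear hfar).trans ?_)
  rw [← ENNReal.ofReal_add (by positivity) (by positivity),
    ← ENNReal.ofReal_add (by positivity) (by positivity)]
  exact ENNReal.ofReal_le_ofReal (by linarith)

lemma NN_comp_ne_top {β δ : ℝ} {σ : ℝ → ℝ} {K : NNReal} (hσ : LipschitzWith K σ)
    {f : ℝ → ℝ → ℝ} {t x : ℝ} (h : NN β δ f t x ≠ ⊤) :
    NN β δ (fun t x => σ (f t x)) t x ≠ ⊤ := by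
  rw [NN_eq_sqNN_rpow]
  exact ENNReal.rpow_ne_top_of_nonneg (by norm_num) (ne_top_of_le_ne_top
    (ENNReal.mul_ne_top ENNReal.ofReal_ne_top (sqNN_Icc_ne_top h)) (sqNN_comp_le hσ β _ f t x))

lemma continuousOn_NN_comp {β T : ℝ} (hβ : 0 < β) {σ : ℝ → ℝ} {K : NNReal}
    (hσ : LipschitzWith K σ) {f : ℝ → ℝ → ℝ} (hf : memX β T f) :
    ContinuousOn (fun p : ℝ × ℝ => (NN β 1 (fun t x => σ (f t x)) p.1 p.2).toReal)
      (Icc (0:ℝ) T ×ˢ univ) := by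
  have hσf : ContinuousOn (fun p : ℝ × ℝ => σ (f p.1 p.2)) (Icc (0:ℝ) T ×ˢ univ) :=
    hσ.continuous.comp_continuousOn hf.1
  have hfin : ∀ p ∈ Icc (0:ℝ) T ×ˢ (univ : Set ℝ),
      sqNN β (Icc (-1) 1) (fun t x => σ (f t x)) p.1 p.2 ≠ ⊤ := fun p hp =>
    sqNN_Icc_ne_top (NN_comp_ne_top hσ (hf.2.1 p.1 hp.1 p.2))
  suffices H : ContinuousOn
      (fun p : ℝ × ℝ => (sqNN β (Icc (-1) 1) (fun t x => σ (f t x)) p.1 p.2).toReal)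
      (Icc (0:ℝ) T ×ˢ univ) by
    refine (H.rpow_const (p := 1/2) fun _ _ => Or.inr (by norm_num)).congr fun p _ => ?_
    simp only [NN_eq_sqNN_rpow, ENNReal.toReal_rpow]
  rintro ⟨t₀, x₀⟩ hp₀
  refine continuousWithinAt_of_locally_uniform_approx_of_continuousWithinAt hp₀ fun u hu => ?_
  obtain ⟨e, he, heu⟩ := Metric.mem_uniformity_dist.1 hu
  obtain ⟨ε, hε0, hε1, hε⟩ := exists_sqNN_le hβ hf (|x₀| + 1)
    (η := ENNReal.ofReal (e / 2 / ((K:ℝ) ^ 2 + 1))) (by simp; positivity)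
  have hdfin : ∀ p ∈ Icc (0:ℝ) T ×ˢ (univ : Set ℝ),
      sqNN β (Icc (-1) 1 \ Icc (-ε) ε) (fun t x => σ (f t x)) p.1 p.2 ≠ ⊤ := fun p hp =>
    ne_top_of_le_ne_top (hfin p hp) (sqNN_mono_set sdiff_subset _ _ _)
  have h1 : ∀ᶠ p : ℝ × ℝ in nhds (t₀, x₀), |p.2| < |x₀| + 1 :=
    (continuous_abs.comp continuous_snd).continuousAt.eventually_lt_const (by simp)
  refine ⟨_, inter_mem (nhdsWithin_le_nhds h1) self_mem_nhdsWithin,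
    fun p => (sqNN β (Icc (-1) 1 \ Icc (-ε) ε) (fun t x => σ (f t x)) p.1 p.2).toReal,
    (ENNReal.tendsto_toReal (hdfin _ hp₀)).comp
      (continuousOn_sqNN_diff (f := fun t x => σ (f t x)) hβ hε0 hσf _ hp₀), ?_⟩
  rintro p ⟨hpx, hp⟩
  apply heu
  have hsmall : sqNN β (Icc (-ε) ε) (fun t x => σ (f t x)) p.1 p.2 ≤ ENNReal.ofReal (e / 2) := by
    refine (sqNN_comp_le hσ β _ f _ _).trans ?_
    refine (mul_le_mul_right (hε p.1 hp.1 p.2 (abs_le.1 (le_of_lt hpx))) _).trans ?_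
    rw [← ENNReal.ofReal_mul (by positivity)]
    refine ENNReal.ofReal_le_ofReal ?_
    rw [mul_div_assoc', div_le_iff₀ (by positivity)]
    nlinarith
  rw [← sqNN_Icc_add_diff β ε 1 hε1, ENNReal.toReal_add
    (ne_top_of_le_ne_top ENNReal.ofReal_ne_top hsmall) (hdfin p hp), Real.dist_eq,
    add_sub_cancel_right, abs_of_nonneg ENNReal.toReal_nonneg]
  exact (ENNReal.toReal_le_of_le_ofReal (by positivity) hsmall).trans_lt (by linarith)

/-- Spatial translations of a continuous function converge locally uniformly. -/
lemma eventually_abs_translate_sub_le {T : ℝ} {f : ℝ → ℝ → ℝ}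
    (hf : ContinuousOn (fun p : ℝ × ℝ => f p.1 p.2) (Icc (0:ℝ) T ×ˢ univ)) (R : ℝ)
    {ε : ℝ} (hε : 0 < ε) :
    ∀ᶠ h : ℝ in nhds 0, ∀ t ∈ Icc (0:ℝ) T, ∀ x ∈ Icc (-R) R, |f t (x - h) - f t x| ≤ ε := by
  have huc := (isCompact_Icc.prod isCompact_Icc).uniformContinuousOn_of_continuous
    (hf.mono (prod_mono_right (subset_univ (Icc (-(R + 1)) (R + 1)))))
  obtain ⟨d, hd, hd'⟩ := Metric.uniformContinuousOn_iff.1 huc ε hε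
  filter_upwards [Metric.ball_mem_nhds (0:ℝ) hd, Metric.ball_mem_nhds (0:ℝ) one_pos]
    with h hhd hh1 t ht x hx
  rw [Metric.mem_ball, Real.dist_eq, sub_zero] at hhd hh1
  have h1 := abs_lt.1 hh1
  refine (hd' (t, x - h) ⟨ht, by constructor <;> linarith [hx.1, hx.2, h1.1, h1.2]⟩ (t, x)
    ⟨ht, by constructor <;> linarith [hx.1, hx.2, h1.1, h1.2]⟩ ?_).le
  simpa [Prod.dist_eq, Real.dist_eq] using hhd

/-- Left composition with a Lipschitz function `σ`: if `f ∈ X^β_T` and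
`t ↦ 𝒩_β^{(1)}(σ∘f)(t,x)` is continuous for each fixed `x`, then `σ∘f ∈ X^β_T`;
moreover, if `f_n → f` in `X^β_T` then for every `R > 0` and `δ > 0`,
`sup_{t∈[0,T], |x|≤R} 𝒩_β^{(δ)}(σ∘f_n - σ∘f)(t,x) → 0`. -/
theorem stmt_12 (β T : ℝ) (hβ : β ∈ Set.Ioo (0:ℝ) 1) (hT : 0 < T)
    (σ : ℝ → ℝ) (K : NNReal) (hσ : LipschitzWith K σ)
    (f : ℝ → ℝ → ℝ) (hf : memX β T f)
    (htcont : ∀ x : ℝ, ContinuousOn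
      (fun t => (NN β 1 (fun t' x' => σ (f t' x')) t x).toReal) (Set.Icc (0:ℝ) T)) :
    memX β T (fun t x => σ (f t x)) ∧
    ∀ fn : ℕ → ℝ → ℝ → ℝ, (∀ n, memX β T (fn n)) → convX β T fn f →
      ∀ R > (0:ℝ), ∀ δ > (0:ℝ),
        Filter.Tendsto
          (fun n : ℕ => ⨆ (t : Set.Icc (0:ℝ) T) (x : Set.Icc (-R) R),
            NN β δ (fun t' x' => σ (fn n t' x') - σ (f t' x')) t.1 x.1)
          Filter.atTop (nhds (0 : ℝ≥0∞)) := by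
  have hβ0 : 0 < β := hβ.1
  refine ⟨⟨hσ.continuous.comp_continuousOn hf.1,
    fun t ht x => NN_comp_ne_top hσ (hf.2.1 t ht x), continuousOn_NN_comp hβ0 hσ hf, ?_⟩, ?_⟩
  · intro R hR
    refine tendsto_iSup_NN_comp_sub (g := fun h t x => f t (x - h)) hβ0 hσ hf ?_ hR one_pos
    intro R' hR' ε hε
    filter_upwards [eventually_abs_translate_sub_le hf.1 R' hε,
      ENNReal.tendsto_nhds_zero.1 (hf.2.2.2 R' hR') _ (ENNReal.ofReal_pos.2 hε)]
      with h h1 h2 t ht x hx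
    exact ⟨h1 t ht x hx, (le_iSup₂ (f := fun (t : Icc (0:ℝ) T) (x : Icc (-R') R') =>
      NN β 1 (fun t' x' => f t' (x' - h) - f t' x') t.1 x.1) ⟨t, ht⟩ ⟨x, hx⟩).trans h2⟩
  · intro fn _ hconv R hR δ hδ
    refine tendsto_iSup_NN_comp_sub hβ0 hσ hf (fun R' hR' ε hε => ?_) hR hδ
    exact eventually_atTop.2 (hconv R' hR' ε hε)
end

section
/- Let T > 0, let g : [0,T] → [0,∞) be integrable, and let (f_n)_{n≥0} be a sequence of measurable functions f_n : [0,T] → [0,∞) such that f_0 is bounded and, for two nonnegative constants c_1, c_2, one has f_n(t) ≤ c_1 + c_2 ∫_0^t g(t−s) f_{n−1}(s) ds for all n ≥ 1 and t ∈ [0,T]. Then sup_{n≥0} sup_{t∈[0,T]} f_n(t) < ∞. If moreover c_1 = 0, then for every p ∈ [1,∞) the series ∑_{n≥0} f_n(t)^{1/p} converges uniformly on [0,T]. -/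
open MeasureTheory Set Filter

/-- The exponentially weighted mass of an integrable function on `[0,T]` is eventually small. -/
theorem exists_mul_integral_mul_exp_neg_le {T : ℝ} {g : ℝ → ℝ}
    (hg : IntegrableOn g (Icc 0 T)) (c : ℝ) {ε : ℝ} (hε : 0 < ε) :
    ∃ β : ℝ, 0 ≤ β ∧ c * ∫ u in Icc 0 T, g u * Real.exp (-(β * u)) ≤ ε := by
  have hlim : Tendsto (fun n : ℕ => ∫ u in Icc 0 T, g u * Real.exp (-((n : ℝ) * u))) atTop
      (nhds (∫ _u in Icc 0 T, (0 : ℝ))) := by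
    refine tendsto_integral_of_dominated_convergence (fun u => ‖g u‖) (fun n => ?_) hg.norm
      (fun n => ?_) ?_
    · exact hg.aestronglyMeasurable.mul (by fun_prop)
    · filter_upwards [ae_restrict_mem measurableSet_Icc] with u hu
      rw [norm_mul, Real.norm_of_nonneg (Real.exp_nonneg _)]
      have : 0 ≤ (n : ℝ) * u := mul_nonneg n.cast_nonneg hu.1
      exact mul_le_of_le_one_right (norm_nonneg _) (Real.exp_le_one_iff.2 (by linarith))
    · filter_upwards [ae_restrict_mem measurableSet_Icc,
        ae_restrict_of_ae (Measure.ae_ne volume (0 : ℝ))] with u hu hu0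
      have hpos : 0 < u := lt_of_le_of_ne hu.1 (Ne.symm hu0)
      have h := Real.tendsto_exp_neg_atTop_nhds_zero.comp
        (tendsto_natCast_atTop_atTop.atTop_mul_const hpos)
      simpa using h.const_mul (g u)
  have hlim' := hlim.const_mul c
  rw [integral_zero, mul_zero] at hlim'
  obtain ⟨n, hn⟩ := (hlim'.eventually_le_const hε).exists
  exact ⟨n, n.cast_nonneg, hn⟩

/-- The convolution of `g` with a function dominated by `A * exp (β * ·)` is dominated by a
multiple of `exp (β * ·)`. -/
theorem integral_convolution_le_exp {T : ℝ} {g h : ℝ → ℝ} (hg0 : ∀ t ∈ Icc 0 T, 0 ≤ g t)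
    (hg : IntegrableOn g (Icc 0 T)) (hh0 : ∀ t ∈ Icc 0 T, 0 ≤ h t) {A β : ℝ} (hA : 0 ≤ A)
    (hh : ∀ t ∈ Icc 0 T, h t ≤ A * Real.exp (β * t)) {t : ℝ} (ht : t ∈ Icc 0 T) :
    ∫ s in (0 : ℝ)..t, g (t - s) * h s ≤
      A * Real.exp (β * t) * ∫ u in Icc 0 T, g u * Real.exp (-(β * u)) := by
  have hgt : IntervalIntegrable g volume 0 t := by
    rw [intervalIntegrable_iff_integrableOn_Icc_of_le ht.1]
    exact hg.mono_set (Icc_subset_Icc_right ht.2)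
  have hgr : IntervalIntegrable (fun s => g (t - s)) volume 0 t := by
    simpa using (hgt.comp_sub_left t).symm
  have hdom : IntervalIntegrable (fun s => g (t - s) * (A * Real.exp (β * s))) volume 0 t :=
    hgr.mul_continuousOn (by fun_prop)
  have hle : ∫ s in (0 : ℝ)..t, g (t - s) * h s ≤
      ∫ s in (0 : ℝ)..t, g (t - s) * (A * Real.exp (β * s)) := by
    rw [intervalIntegral.integral_of_le ht.1, intervalIntegral.integral_of_le ht.1]
    refine integral_mono_of_nonneg ?_ hdom.1 ?_
    all_goals
      filter_upwards [ae_restrict_mem measurableSet_Ioc] with s hs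
      have hsT : s ∈ Icc 0 T := ⟨hs.1.le, hs.2.trans ht.2⟩
      have htsT : t - s ∈ Icc 0 T := ⟨by linarith [hs.2], by linarith [hs.1, ht.2]⟩
    · exact mul_nonneg (hg0 _ htsT) (hh0 _ hsT)
    · exact mul_le_mul_of_nonneg_left (hh _ hsT) (hg0 _ htsT)
  have hsubst : ∫ s in (0 : ℝ)..t, g (t - s) * (A * Real.exp (β * s)) =
      A * Real.exp (β * t) * ∫ u in (0 : ℝ)..t, g u * Real.exp (-(β * u)) := by
    have h := intervalIntegral.integral_comp_sub_left (a := 0) (b := t)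
      (fun u => g u * (A * Real.exp (β * (t - u)))) t
    simp only [sub_sub_cancel, sub_self, sub_zero] at h
    rw [h, ← intervalIntegral.integral_const_mul]
    refine intervalIntegral.integral_congr fun u _ => ?_
    have : Real.exp (β * (t - u)) = Real.exp (β * t) * Real.exp (-(β * u)) := by
      rw [← Real.exp_add]; ring_nf
    simp only [this]
    ring
  have hmono : ∫ u in (0 : ℝ)..t, g u * Real.exp (-(β * u)) ≤
      ∫ u in Icc 0 T, g u * Real.exp (-(β * u)) := by
    rw [intervalIntegral.integral_of_le ht.1]
    refine setIntegral_mono_set (hg.mul_continuousOn (by fun_prop) isCompact_Icc) ?_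
      (Ioc_subset_Icc_self.trans (Icc_subset_Icc_right ht.2)).eventuallyLE
    filter_upwards [ae_restrict_mem measurableSet_Icc] with u hu
    exact mul_nonneg (hg0 u hu) (Real.exp_nonneg _)
  calc _ ≤ _ := hle
    _ = _ := hsubst
    _ ≤ _ := mul_le_mul_of_nonneg_left hmono (by positivity)

/-- Gronwall-type lemma: if `g ∈ L¹([0,T]; ℝ₊)` and the nonnegative measurable functions
`f_n` satisfy `f_0` bounded and `f_n(t) ≤ c₁ + c₂ ∫_0^t g(t-s) f_{n-1}(s) ds`, then
`sup_n f_n` is bounded on `[0,T]`; if moreover `c₁ = 0`, then for every `p ∈ [1,∞)` the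
series `∑_n f_n(t)^{1/p}` converges uniformly on `[0,T]`. -/
theorem stmt_13 (T : ℝ) (hT : 0 < T)
    (g : ℝ → ℝ) (hg0 : ∀ t ∈ Set.Icc (0:ℝ) T, 0 ≤ g t)
    (hgInt : IntegrableOn g (Set.Icc (0:ℝ) T))
    (c₁ c₂ : ℝ) (hc₁ : 0 ≤ c₁) (hc₂ : 0 ≤ c₂)
    (f : ℕ → ℝ → ℝ)
    (hfmeas : ∀ n, AEMeasurable (f n) (volume.restrict (Set.Icc (0:ℝ) T)))
    (hf0 : ∀ n, ∀ t ∈ Set.Icc (0:ℝ) T, 0 ≤ f n t)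
    (hfbdd : ∃ M : ℝ, ∀ t ∈ Set.Icc (0:ℝ) T, f 0 t ≤ M)
    (hrec : ∀ n : ℕ, 1 ≤ n → ∀ t ∈ Set.Icc (0:ℝ) T,
      f n t ≤ c₁ + c₂ * ∫ s in (0:ℝ)..t, g (t - s) * f (n - 1) s) :
    (∃ M : ℝ, ∀ n : ℕ, ∀ t ∈ Set.Icc (0:ℝ) T, f n t ≤ M) ∧
    (c₁ = 0 → ∀ p : ℝ, 1 ≤ p → ∃ S : ℝ → ℝ,
      TendstoUniformlyOn (fun (N : ℕ) (t : ℝ) => ∑ n ∈ Finset.range N, f n t ^ (1 / p))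
        S atTop (Set.Icc (0:ℝ) T)) := by
  obtain ⟨M, hM⟩ := hfbdd
  have hM0 : 0 ≤ M :=
    (hf0 0 0 ⟨le_rfl, hT.le⟩).trans (hM 0 ⟨le_rfl, hT.le⟩)
  obtain ⟨β, hβ, hsmall⟩ := exists_mul_integral_mul_exp_neg_le hgInt c₂ (one_half_pos (α := ℝ))
  have hbound : ∀ n : ℕ, ∀ t ∈ Icc 0 T,
      f n t ≤ (2 * c₁ + M * (1 / 2) ^ n) * Real.exp (β * t) := by
    intro n
    induction n with
    | zero =>
      intro t ht
      have h1 : 1 ≤ Real.exp (β * t) := Real.one_le_exp (mul_nonneg hβ ht.1)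
      nlinarith [hM t ht]
    | succ n ih =>
      intro t ht
      have h1 : 1 ≤ Real.exp (β * t) := Real.one_le_exp (mul_nonneg hβ ht.1)
      have hA : 0 ≤ 2 * c₁ + M * (1 / 2) ^ n := by positivity
      have hconv := mul_le_mul_of_nonneg_left
        (integral_convolution_le_exp hg0 hgInt (hf0 n) hA ih ht) hc₂
      have hhalf := mul_le_mul_of_nonneg_left hsmall (mul_nonneg hA (Real.exp_nonneg (β * t)))
      have hc := mul_le_mul_of_nonneg_left h1 hc₁
      have hr := hrec (n + 1) n.succ_pos t ht
      rw [Nat.add_sub_cancel] at hr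
      rw [pow_succ]
      linarith
  have hexp : ∀ t ∈ Icc 0 T, Real.exp (β * t) ≤ Real.exp (β * T) := fun t ht =>
    Real.exp_le_exp.2 (mul_le_mul_of_nonneg_left ht.2 hβ)
  refine ⟨⟨(2 * c₁ + M) * Real.exp (β * T), fun n t ht => (hbound n t ht).trans ?_⟩, ?_⟩
  · have hpow : M * (1 / 2 : ℝ) ^ n ≤ M :=
      mul_le_of_le_one_right hM0 (pow_le_one₀ (by norm_num) (by norm_num))
    exact mul_le_mul (by linarith) (hexp t ht) (Real.exp_nonneg _) (by positivity)
  · rintro rfl p hp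
    have hp' : 0 < 1 / p := by positivity
    have hsum : Summable fun n : ℕ =>
        (M * Real.exp (β * T)) ^ (1 / p) * (((1 / 2 : ℝ) ^ (1 / p)) ^ n) :=
      (summable_geometric_of_lt_one (by positivity)
        (Real.rpow_lt_one (by norm_num) (by norm_num) hp')).mul_left _
    refine ⟨_, tendstoUniformlyOn_tsum_nat hsum fun n t ht => ?_⟩
    rw [Real.norm_of_nonneg (Real.rpow_nonneg (hf0 n t ht) _), Real.rpow_pow_comm (by norm_num),
      ← Real.mul_rpow (by positivity) (by positivity)]
    refine Real.rpow_le_rpow (hf0 n t ht) ?_ hp'.le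
    calc f n t ≤ M * (1 / 2) ^ n * Real.exp (β * t) := by simpa using hbound n t ht
      _ ≤ M * (1 / 2) ^ n * Real.exp (β * T) :=
        mul_le_mul_of_nonneg_left (hexp t ht) (by positivity)
      _ = M * Real.exp (β * T) * (1 / 2) ^ n := by ring
end

section
/- Let E be a Polish space with metric d, equipped with its Borel σ-algebra, let (Ω, ℱ, P) be a probability space, and let (z_n) be a sequence of measurable maps z_n : Ω → E. Then (z_n) converges in probability to some measurable z : Ω → E (i.e., for every ε > 0, P(d(z_n, z) > ε) → 0) if and only if for every pair of strictly increasing sequences of indices (l(n)) and (m(n)) there exists a subsequence (n_k) such that the laws of the pairs (z_{l(n_k)}, z_{m(n_k)}) on E×E converge weakly, as k → ∞, to a probability measure μ on E×E with μ({(x,y) ∈ E×E : x = y}) = 1. -/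
open MeasureTheory Filter

section GyongyKrylov

variable {E Ω : Type*} [MetricSpace E] [SecondCountableTopology E] [MeasurableSpace E]
  [BorelSpace E] [MeasurableSpace Ω] {P : Measure Ω}

/-- If along any two subsequences the joint laws have a further subsequence converging weakly to a
probability measure carried by the diagonal, then the sequence is Cauchy in probability. -/
theorem cauchy_integral_min_dist_of_joint_laws {z : ℕ → Ω → E}
    (h : ∀ l m : ℕ → ℕ, StrictMono l → StrictMono m →
      ∃ ns : ℕ → ℕ, StrictMono ns ∧ ∃ μ : Measure (E × E), IsProbabilityMeasure μ ∧
        μ {p : E × E | p.1 = p.2} = 1 ∧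
        ∀ F : E × E → ℝ, Continuous F → (∃ M : ℝ, ∀ p, |F p| ≤ M) →
          Tendsto (fun k => ∫ ω, F (z (l (ns k)) ω, z (m (ns k)) ω) ∂P) atTop
            (nhds (∫ p, F p ∂μ)))
    {δ : ℝ} (hδ : 0 < δ) :
    ∃ N, ∀ p ≥ N, ∀ q ≥ N, ∫ ω, min 1 (dist (z p ω) (z q ω)) ∂P < δ := by
  have hlim : Tendsto (fun r : ℕ × ℕ => ∫ ω, min 1 (dist (z r.1 ω) (z r.2 ω)) ∂P) atTop
      (nhds 0) := by
    refine tendsto_of_subseq_tendsto fun r hr => ?_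
    rw [← prod_atTop_atTop_eq] at hr
    obtain ⟨a, ha, hla⟩ := strictMono_subseq_of_tendsto_atTop (tendsto_fst.comp hr)
    obtain ⟨b, hb, hmb⟩ := strictMono_subseq_of_tendsto_atTop
      ((tendsto_snd.comp hr).comp ha.tendsto_atTop)
    obtain ⟨ns, -, μ, hμ, hdiag, hF⟩ := h _ _ (hla.comp hb) hmb
    refine ⟨fun k => a (b (ns k)), ?_⟩
    have hconv := hF (fun p => min 1 (dist p.1 p.2)) (by fun_prop) ⟨1, fun p => by
      rw [abs_of_nonneg (le_min zero_le_one dist_nonneg)]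
      exact min_le_left _ _⟩
    have hae : ∀ᵐ p ∂μ, p.1 = p.2 :=
      (prob_compl_eq_zero_iff (isClosed_eq continuous_fst continuous_snd).measurableSet).2 hdiag
    have hint : ∫ p, min 1 (dist p.1 p.2) ∂μ = 0 := by
      refine integral_eq_zero_of_ae ?_
      filter_upwards [hae] with p hp
      simp [hp]
    rw [hint] at hconv
    exact hconv
  exact eventually_atTop_prod_self'.1 (hlim.eventually_lt_const hδ)

variable [IsProbabilityMeasure P]

/-- The truncated distance of two random elements is integrable. -/
theorem integrable_min_one_dist {u v : Ω → E} (hu : Measurable u) (hv : Measurable v) :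
    Integrable (fun ω => min 1 (dist (u ω) (v ω))) P := by
  refine Integrable.of_bound (measurable_const.min (hu.dist hv)).aestronglyMeasurable 1
    (ae_of_all _ fun ω => ?_)
  rw [Real.norm_of_nonneg (le_min zero_le_one dist_nonneg)]
  exact min_le_left _ _

/-- Markov's inequality for the truncated distance of two random elements. -/
theorem measure_le_dist_le_ofReal_integral_div {u v : Ω → E} (hu : Measurable u)
    (hv : Measurable v) {η : ℝ} (hη : 0 < η) (hη1 : η ≤ 1) :
    P {ω | η ≤ dist (u ω) (v ω)} ≤
      ENNReal.ofReal ((∫ ω, min 1 (dist (u ω) (v ω)) ∂P) / η) := by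
  have h := mul_meas_ge_le_integral_of_nonneg (μ := P)
    (ae_of_all _ fun ω => le_min zero_le_one dist_nonneg) (integrable_min_one_dist hu hv) η
  have hset : {ω | η ≤ min 1 (dist (u ω) (v ω))} = {ω | η ≤ dist (u ω) (v ω)} := by
    ext ω
    simp [hη1]
  rw [hset] at h
  rw [← ofReal_measureReal]
  exact ENNReal.ofReal_le_ofReal ((le_div_iff₀' hη).2 h)

/-- A sequence of random elements of a complete space which is Cauchy in probability converges
in probability. -/
theorem exists_measurable_tendsto_of_cauchy_integral_min_dist [CompleteSpace E] {z : ℕ → Ω → E}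
    (hz : ∀ n, Measurable (z n))
    (hcauchy : ∀ δ > (0 : ℝ), ∃ N, ∀ p ≥ N, ∀ q ≥ N,
      ∫ ω, min 1 (dist (z p ω) (z q ω)) ∂P < δ) :
    ∃ w : Ω → E, Measurable w ∧ ∀ ε > (0 : ℝ),
      Tendsto (fun n => P {ω | ε < dist (z n ω) (w ω)}) atTop (nhds 0) := by
  obtain ⟨φ, hφ, hφI⟩ := extraction_forall_of_eventually'
    (P := fun n k => ∀ q ≥ k, ∫ ω, min 1 (dist (z k ω) (z q ω)) ∂P < (1 / 4 : ℝ) ^ n)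
    (fun n => by
      obtain ⟨N, hN⟩ := hcauchy ((1 / 4 : ℝ) ^ n) (by positivity)
      exact ⟨N, fun k hk q hq => hN k hk q (le_trans hk hq)⟩)
  have hsum : ∑' k, P {ω | (1 / 2 : ℝ) ^ k ≤ dist (z (φ k) ω) (z (φ (k + 1)) ω)} ≠ ⊤ := by
    refine ne_top_of_le_ne_top (summable_geometric_two.tsum_ofReal_ne_top)
      (ENNReal.tsum_le_tsum fun k => ?_)
    refine (measure_le_dist_le_ofReal_integral_div (hz _) (hz _) (by positivity)
      (pow_le_one₀ (by norm_num) (by norm_num))).trans (ENNReal.ofReal_le_ofReal ?_)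
    rw [div_le_iff₀ (by positivity), ← mul_pow]
    norm_num only
    simpa only [one_div] using (hφI k _ (hφ k.lt_succ_self).le).le
  have hconv : ∀ᵐ ω ∂P, ∃ x, Tendsto (fun k => z (φ k) ω) atTop (nhds x) := by
    filter_upwards [ae_eventually_notMem hsum] with ω hω
    obtain ⟨N, hN⟩ := eventually_atTop.1 hω
    refine cauchySeq_tendsto_of_complete ((cauchySeq_shift N).1 ?_)
    refine cauchySeq_of_le_geometric (1 / 2) ((1 / 2) ^ N) (by norm_num) fun k => ?_
    have h := hN (k + N) (Nat.le_add_left _ _)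
    rw [not_le] at h
    rw [← pow_add, add_comm N k, add_right_comm]
    exact h.le
  obtain ⟨w, hw, hwlim⟩ := measurable_limit_of_tendsto_metrizable_ae
    (fun k => (hz (φ k)).aemeasurable) hconv
  have hlim : ∀ n, Tendsto (fun k => ∫ ω, min 1 (dist (z n ω) (z (φ k) ω)) ∂P) atTop
      (nhds (∫ ω, min 1 (dist (z n ω) (w ω)) ∂P)) := by
    intro n
    refine tendsto_integral_of_dominated_convergence (fun _ => 1)
      (fun k => (integrable_min_one_dist (hz n) (hz _)).aestronglyMeasurable)
      (integrable_const _) (fun k => ae_of_all _ fun ω => ?_) ?_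
    · rw [Real.norm_of_nonneg (le_min zero_le_one dist_nonneg)]
      exact min_le_left _ _
    · filter_upwards [hwlim] with ω hω
      exact tendsto_const_nhds.min (tendsto_const_nhds.dist hω)
  have hzero : Tendsto (fun n => ∫ ω, min 1 (dist (z n ω) (w ω)) ∂P) atTop (nhds 0) := by
    refine Metric.tendsto_atTop.2 fun δ hδ => ?_
    obtain ⟨N, hN⟩ := hcauchy (δ / 2) (half_pos hδ)
    refine ⟨N, fun n hn => ?_⟩
    have hle : ∫ ω, min 1 (dist (z n ω) (w ω)) ∂P ≤ δ / 2 := by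
      refine le_of_tendsto (hlim n) ?_
      filter_upwards [hφ.tendsto_atTop.eventually_ge_atTop N] with k hk
      exact (hN n hn _ hk).le
    rw [dist_zero_right, Real.norm_of_nonneg
      (integral_nonneg fun ω => le_min zero_le_one dist_nonneg)]
    linarith
  refine ⟨w, hw, fun ε hε => ?_⟩
  have hη : 0 < min 1 ε := lt_min one_pos hε
  have hbound : Tendsto (fun n => ENNReal.ofReal
      ((∫ ω, min 1 (dist (z n ω) (w ω)) ∂P) / min 1 ε)) atTop (nhds 0) := by
    simpa using ENNReal.tendsto_ofReal (hzero.div_const (min 1 ε))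
  refine tendsto_of_tendsto_of_tendsto_of_le_of_le tendsto_const_nhds hbound
    (fun _ => zero_le) fun n => ?_
  refine (measure_mono fun ω hω => ?_).trans
    (measure_le_dist_le_ofReal_integral_div (hz n) hw hη (min_le_left _ _))
  exact (min_le_right _ _).trans (show ε < dist (z n ω) (w ω) from hω).le

/-- If a sequence converges in probability, then along any two subsequences the joint laws have a
further subsequence converging weakly to the law of the limit on the diagonal. -/
theorem exists_subseq_tendsto_integral_pair {z : ℕ → Ω → E} (hz : ∀ n, Measurable (z n))
    {w : Ω → E} (hw : Measurable w) (h : TendstoInMeasure P z atTop w) {l m : ℕ → ℕ}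
    (hl : StrictMono l) (hm : StrictMono m) :
    ∃ ns : ℕ → ℕ, StrictMono ns ∧
      ∀ F : E × E → ℝ, Continuous F → (∃ M : ℝ, ∀ p, |F p| ≤ M) →
        Tendsto (fun k => ∫ ω, F (z (l (ns k)) ω, z (m (ns k)) ω) ∂P) atTop
          (nhds (∫ p, F p ∂P.map fun ω => (w ω, w ω))) := by
  obtain ⟨a, ha, hla⟩ := (h.comp hl.tendsto_atTop).exists_seq_tendsto_ae
  obtain ⟨b, hb, hmb⟩ := (h.comp (hm.comp ha).tendsto_atTop).exists_seq_tendsto_ae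
  refine ⟨a ∘ b, ha.comp hb, fun F hFc ⟨M, hM⟩ => ?_⟩
  rw [integral_map (hw.prodMk hw).aemeasurable hFc.aestronglyMeasurable]
  refine tendsto_integral_of_dominated_convergence (fun _ => M)
    (fun k => (hFc.measurable.comp ((hz _).prodMk (hz _))).aestronglyMeasurable)
    (integrable_const _) (fun k => ae_of_all _ fun ω => hM _) ?_
  filter_upwards [hla, hmb] with ω h₁ h₂
  exact (hFc.tendsto _).comp ((h₁.comp hb.tendsto_atTop).prodMk_nhds h₂)

end GyongyKrylov

/-- Gyöngy–Krylov lemma: a sequence of random elements `z_n` with values in a Polish space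
`E` converges in probability to some random element `z` if and only if for every pair of
strictly increasing sequences of indices `(l(n))`, `(m(n))` there is a subsequence `(n_k)`
such that the laws of the pairs `(z_{l(n_k)}, z_{m(n_k)})` converge weakly to a probability
measure on `E × E` supported on the diagonal. -/
theorem stmt_14 {E : Type*} [MetricSpace E] [TopologicalSpace.SeparableSpace E]
    [CompleteSpace E] [MeasurableSpace E] [BorelSpace E]
    {Ω : Type*} [MeasurableSpace Ω] (P : Measure Ω) [IsProbabilityMeasure P]
    (z : ℕ → Ω → E) (hz : ∀ n, Measurable (z n)) :
    (∃ w : Ω → E, Measurable w ∧ ∀ ε > (0:ℝ),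
      Tendsto (fun n => P {ω | ε < dist (z n ω) (w ω)}) atTop (nhds 0)) ↔
    (∀ l m : ℕ → ℕ, StrictMono l → StrictMono m →
      ∃ ns : ℕ → ℕ, StrictMono ns ∧ ∃ μ : Measure (E × E), IsProbabilityMeasure μ ∧
        μ {p : E × E | p.1 = p.2} = 1 ∧
        ∀ F : E × E → ℝ, Continuous F → (∃ M : ℝ, ∀ p, |F p| ≤ M) →
          Tendsto (fun k => ∫ ω, F (z (l (ns k)) ω, z (m (ns k)) ω) ∂P) atTop
            (nhds (∫ p, F p ∂μ))) := by
  have := UniformSpace.secondCountable_of_separable E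
  refine ⟨fun ⟨w, hw, h⟩ l m hl hm => ?_, fun h =>
    exists_measurable_tendsto_of_cauchy_integral_min_dist hz fun δ hδ =>
      cauchy_integral_min_dist_of_joint_laws h hδ⟩
  have hmeas : TendstoInMeasure P z atTop w := by
    refine tendstoInMeasure_iff_dist.2 fun ε hε => ?_
    refine tendsto_of_tendsto_of_tendsto_of_le_of_le tendsto_const_nhds (h (ε / 2) (half_pos hε))
      (fun _ => zero_le) fun n => measure_mono fun ω hω => ?_
    exact (half_lt_self hε).trans_le hω
  obtain ⟨ns, hns, hF⟩ := exists_subseq_tendsto_integral_pair hz hw hmeas hl hm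
  refine ⟨ns, hns, P.map fun ω => (w ω, w ω),
    Measure.isProbabilityMeasure_map (hw.prodMk hw).aemeasurable, ?_, hF⟩
  rw [Measure.map_apply (hw.prodMk hw)
    (isClosed_eq continuous_fst continuous_snd).measurableSet]
  simp
end

section
/- Let ε > 0. There exists a constant c > 0, depending only on ε, such that for every integer m ≥ 1, every α = (α_1, …, α_m) with α_i ∈ (−1+ε, 1) for all i, and every t ≥ 0, one has ∫_{T_m(t)} ∏_{i=1}^m (r_i − r_{i−1})^{α_i} dr_1 ⋯ dr_m ≤ c^m t^{|α|+m} / Γ(|α| + m + 1), where r_0 = 0, |α| = ∑_{i=1}^m α_i, T_m(t) = {(r_1,…,r_m) ∈ ℝ^m : 0 < r_1 < ⋯ < r_m < t}, and Γ is the Gamma function. -/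
open MeasureTheory

/-- `prevCoord r i` is `r_{i-1}`, with the convention `r_0 = 0`. -/
def prevCoord {m : ℕ} (r : Fin m → ℝ) (i : Fin m) : ℝ :=
  if _h : (i : ℕ) = 0 then 0
  else r ⟨(i : ℕ) - 1, lt_of_le_of_lt (Nat.sub_le _ _) i.isLt⟩

/-- The open simplex `T_m(t) = {0 < r_1 < ⋯ < r_m < t}`. -/
def simplex (m : ℕ) (t : ℝ) : Set (Fin m → ℝ) :=
  {r | ∀ i, prevCoord r i < r i ∧ r i < t}

lemma prevCoord_zero {m : ℕ} (r : Fin (m + 1) → ℝ) : prevCoord r 0 = 0 := by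
  simp [prevCoord]

lemma prevCoord_cons_add_succ {m : ℕ} (s : ℝ) (q : Fin m → ℝ) (i : Fin m) :
    prevCoord (Fin.cons s (fun j => q j + s) : Fin (m + 1) → ℝ) i.succ = prevCoord q i + s := by
  obtain ⟨i, hi⟩ := i
  cases i with
  | zero => simp [prevCoord]
  | succ j => rfl

lemma measurable_prevCoord {m : ℕ} (i : Fin m) :
    Measurable (fun r : Fin m → ℝ => prevCoord r i) := by
  unfold prevCoord
  split_ifs <;> fun_prop

lemma measurableSet_simplex (m : ℕ) (t : ℝ) : MeasurableSet (simplex m t) := by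
  have h : simplex m t = ⋂ i, {r | prevCoord r i < r i} ∩ {r | r i < t} := by
    ext r; simp [simplex]
  rw [h]
  exact MeasurableSet.iInter fun i =>
    (measurableSet_lt (measurable_prevCoord i) (measurable_pi_apply i)).inter
      (measurableSet_lt (measurable_pi_apply i) measurable_const)

lemma simplex_zero (t : ℝ) : simplex 0 t = Set.univ := by
  ext r; simp [simplex]

lemma cons_add_mem_simplex_iff {m : ℕ} (t s : ℝ) (q : Fin m → ℝ) :
    (Fin.cons s (fun j => q j + s) : Fin (m + 1) → ℝ) ∈ simplex (m + 1) t ↔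
      s ∈ Set.Ioo 0 t ∧ q ∈ simplex m (t - s) := by
  simp [simplex, Fin.forall_fin_succ, prevCoord_zero, prevCoord_cons_add_succ, lt_sub_iff_add_lt]

/-- Integration over `Fin (m + 1) → ℝ` in the first coordinate and the increments from it. -/
lemma lintegral_pi_succ_eq_lintegral_cons_add {m : ℕ} {f : (Fin (m + 1) → ℝ) → ENNReal}
    (hf : Measurable f) :
    ∫⁻ r, f r = ∫⁻ s : ℝ, ∫⁻ q : Fin m → ℝ, f (Fin.cons s (fun j => q j + s)) := by
  have e := (volume_preserving_piFinSuccAbove (fun _ : Fin (m + 1) => ℝ) 0).symm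
  rw [← e.lintegral_comp hf, Measure.volume_eq_prod, lintegral_prod _ (by fun_prop)]
  refine lintegral_congr fun s => ?_
  rw [← lintegral_add_right_eq_self _ (fun _ : Fin m => s)]
  refine lintegral_congr fun q => ?_
  simp only [MeasurableEquiv.piFinSuccAbove_symm_apply, Fin.insertNthEquiv_zero]
  rfl

lemma lintegral_Ioo_rpow_mul_sub_rpow {a b t : ℝ} (ha : 0 < a) (hb : 0 < b) (ht : 0 < t) :
    ∫⁻ x in Set.Ioo 0 t, ENNReal.ofReal (x ^ (a - 1) * (t - x) ^ (b - 1)) =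
      ENNReal.ofReal (ProbabilityTheory.beta a b * t ^ (a + b - 1)) := by
  have hB := ProbabilityTheory.beta_pos ha hb
  have himage : (fun x => t * x) '' Set.Ioo 0 1 = Set.Ioo 0 t := by
    simpa using Set.image_mul_left_Ioo ht 0 1
  have hderiv : ∀ x ∈ Set.Ioo (0 : ℝ) 1, HasDerivWithinAt (fun x => t * x) t (Set.Ioo 0 1) x :=
    fun x _ => by simpa using ((hasDerivAt_id x).const_mul t).hasDerivWithinAt
  rw [← himage, lintegral_image_eq_lintegral_abs_deriv_mul measurableSet_Ioo hderiv
    (mul_right_injective₀ ht.ne').injOn]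
  have hcongr : ∀ x ∈ Set.Ioo (0 : ℝ) 1,
      ENNReal.ofReal |t| * ENNReal.ofReal ((t * x) ^ (a - 1) * (t - t * x) ^ (b - 1)) =
        ENNReal.ofReal (ProbabilityTheory.beta a b * t ^ (a + b - 1)) *
          ENNReal.ofReal (1 / ProbabilityTheory.beta a b * x ^ (a - 1) * (1 - x) ^ (b - 1)) := by
    intro x hx
    have hx1 : 0 ≤ 1 - x := by linarith [hx.2]
    rw [← ENNReal.ofReal_mul (abs_nonneg t), ← ENNReal.ofReal_mul (by positivity), abs_of_pos ht,
      show t - t * x = t * (1 - x) by ring, Real.mul_rpow ht.le hx.1.le, Real.mul_rpow ht.le hx1,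
      show a + b - 1 = 1 + (a - 1) + (b - 1) by ring, Real.rpow_add ht, Real.rpow_add ht,
      Real.rpow_one]
    congr 1
    field_simp
  rw [setLIntegral_congr_fun measurableSet_Ioo hcongr, lintegral_const_mul _ (by fun_prop),
    ← ProbabilityTheory.lintegral_betaPDF, ProbabilityTheory.lintegral_betaPDF_eq_one ha hb,
    mul_one]

lemma sum_add_card_nonneg {m : ℕ} {α : Fin m → ℝ} (hα : ∀ i, -1 < α i) :
    0 ≤ (∑ i, α i) + m := by
  have h : 0 ≤ ∑ i, (α i + 1) := Finset.sum_nonneg fun i _ => by linarith [hα i]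
  simpa [Finset.sum_add_distrib] using h

lemma measurable_prod_sub_prevCoord_rpow {m : ℕ} (α : Fin m → ℝ) :
    Measurable (fun r : Fin m → ℝ => ENNReal.ofReal (∏ i, (r i - prevCoord r i) ^ α i)) := by
  refine (Finset.measurable_fun_prod _ fun i _ => ?_).ennreal_ofReal
  exact ((measurable_pi_apply i).sub (measurable_prevCoord i)).pow_const _

lemma lintegral_simplex_succ {m : ℕ} (α : Fin (m + 1) → ℝ) (t : ℝ) :
    ∫⁻ r in simplex (m + 1) t, ENNReal.ofReal (∏ i, (r i - prevCoord r i) ^ α i) =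
      ∫⁻ s in Set.Ioo 0 t, ENNReal.ofReal (s ^ α 0) *
        ∫⁻ q in simplex m (t - s),
          ENNReal.ofReal (∏ i : Fin m, (q i - prevCoord q i) ^ α i.succ) := by
  rw [← lintegral_indicator (measurableSet_simplex _ _), lintegral_pi_succ_eq_lintegral_cons_add
    ((measurable_prod_sub_prevCoord_rpow α).indicator (measurableSet_simplex _ _)),
    ← lintegral_indicator measurableSet_Ioo]
  refine lintegral_congr fun s => ?_
  by_cases hs : s ∈ Set.Ioo 0 t
  · rw [Set.indicator_of_mem hs, ← lintegral_indicator (measurableSet_simplex _ _),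
      ← lintegral_const_mul _ ((measurable_prod_sub_prevCoord_rpow _).indicator
        (measurableSet_simplex _ _))]
    refine lintegral_congr fun q => ?_
    by_cases hq : q ∈ simplex m (t - s)
    · rw [Set.indicator_of_mem ((cons_add_mem_simplex_iff t s q).2 ⟨hs, hq⟩),
        Set.indicator_of_mem hq, ← ENNReal.ofReal_mul (Real.rpow_nonneg hs.1.le _),
        Fin.prod_univ_succ]
      simp [prevCoord_zero, prevCoord_cons_add_succ]
    · rw [Set.indicator_of_notMem (by simp [cons_add_mem_simplex_iff, hq]),
        Set.indicator_of_notMem hq, mul_zero]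
  · rw [Set.indicator_of_notMem hs]
    refine (lintegral_congr fun q => ?_).trans lintegral_zero
    exact Set.indicator_of_notMem (fun h => hs ((cons_add_mem_simplex_iff t s q).1 h).1) _

/-- The Dirichlet integral over the simplex. -/
lemma lintegral_simplex_prod_rpow {m : ℕ} {α : Fin m → ℝ} (hα : ∀ i, -1 < α i) {t : ℝ}
    (ht : 0 ≤ t) :
    ∫⁻ r in simplex m t, ENNReal.ofReal (∏ i, (r i - prevCoord r i) ^ α i) =
      ENNReal.ofReal ((∏ i, Real.Gamma (α i + 1)) * t ^ ((∑ i, α i) + m) /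
        Real.Gamma ((∑ i, α i) + m + 1)) := by
  induction m generalizing t with
  | zero => simp [simplex_zero, volume_pi]
  | succ m ih =>
    have hS := sum_add_card_nonneg fun i : Fin m => hα i.succ
    have h0 : 0 < α 0 + 1 := by linarith [hα 0]
    set S := ∑ i : Fin m, α i.succ with hSdef
    have hP : 0 < ∏ i : Fin m, Real.Gamma (α i.succ + 1) :=
      Finset.prod_pos fun i _ => Real.Gamma_pos_of_pos (by linarith [hα i.succ])
    have hG : 0 < Real.Gamma (S + m + 1) := Real.Gamma_pos_of_pos (by linarith)
    set C := (∏ i : Fin m, Real.Gamma (α i.succ + 1)) / Real.Gamma (S + m + 1) with hC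
    have hC0 : 0 < C := div_pos hP hG
    rw [lintegral_simplex_succ, Fin.sum_univ_succ, Fin.prod_univ_succ, ← hSdef]
    push_cast
    rcases ht.eq_or_lt with rfl | ht
    · simp [Real.zero_rpow (show α 0 + S + (m + 1) ≠ 0 by linarith)]
    have hcongr : ∀ s ∈ Set.Ioo 0 t, ENNReal.ofReal (s ^ α 0) *
        ∫⁻ q in simplex m (t - s),
          ENNReal.ofReal (∏ i : Fin m, (q i - prevCoord q i) ^ α i.succ) =
        ENNReal.ofReal C *
          ENNReal.ofReal (s ^ (α 0 + 1 - 1) * (t - s) ^ (S + m + 1 - 1)) := by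
      intro s hs
      rw [ih (fun i => hα i.succ) (sub_nonneg.2 hs.2.le),
        ← ENNReal.ofReal_mul (Real.rpow_nonneg hs.1.le _), ← ENNReal.ofReal_mul hC0.le, ← hSdef,
        add_sub_cancel_right, add_sub_cancel_right, hC]
      congr 1
      ring
    rw [setLIntegral_congr_fun measurableSet_Ioo hcongr, lintegral_const_mul _ (by fun_prop),
      lintegral_Ioo_rpow_mul_sub_rpow h0 (by linarith) ht, ← ENNReal.ofReal_mul hC0.le, hC,
      ProbabilityTheory.beta,
      show α 0 + 1 + (S + m + 1) - 1 = α 0 + S + (m + 1) by ring,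
      show α 0 + 1 + (S + m + 1) = α 0 + S + (m + 1) + 1 by ring]
    congr 1
    field_simp

/-- For every `ε > 0` there is `c > 0` such that for all `m ≥ 1`, all
`α ∈ (-1+ε, 1)^m` and all `t ≥ 0`,
`∫_{T_m(t)} ∏_{i=1}^m (r_i - r_{i-1})^{α_i} dr ≤ c^m t^{|α|+m} / Γ(|α|+m+1)`. -/
theorem stmt_15 (ε : ℝ) (hε : 0 < ε) :
    ∃ c : ℝ, 0 < c ∧ ∀ m : ℕ, 1 ≤ m → ∀ α : Fin m → ℝ,
      (∀ i, α i ∈ Set.Ioo (-1 + ε) 1) → ∀ t : ℝ, 0 ≤ t →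
      (∫⁻ r in simplex m t, ENNReal.ofReal (∏ i, (r i - prevCoord r i) ^ α i))
        ≤ ENNReal.ofReal
            (c ^ m * t ^ ((∑ i, α i) + m) / Real.Gamma ((∑ i, α i) + m + 1)) := by
  refine ⟨max (Real.Gamma ε) (Real.Gamma 2), lt_max_of_lt_left (Real.Gamma_pos_of_pos hε), ?_⟩
  intro m _ α hα t ht
  have hα' : ∀ i, -1 < α i := fun i => by linarith [(hα i).1]
  rw [lintegral_simplex_prod_rpow hα' ht]
  have hG : 0 < Real.Gamma ((∑ i, α i) + m + 1) :=
    Real.Gamma_pos_of_pos (by linarith [sum_add_card_nonneg hα'])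
  have hprod : ∏ i, Real.Gamma (α i + 1) ≤ max (Real.Gamma ε) (Real.Gamma 2) ^ m := by
    rw [← Fin.prod_const]
    refine Finset.prod_le_prod
      (fun i _ => (Real.Gamma_pos_of_pos (by linarith [hα' i])).le) fun i _ => ?_
    exact Real.convexOn_Gamma.le_max_of_mem_Icc hε (Set.mem_Ioi.2 two_pos)
      ⟨by linarith [(hα i).1], by linarith [(hα i).2]⟩
  gcongr
end

section
/- Let H ∈ (0,1/2). There exists a finite constant C, depending only on H, such that for all a > 0, all h ∈ ℝ, and all γ ∈ [0, 2H], ∫_ℝ (1 − e^{−a ξ²/2})² sin²(ξ h / 2) |ξ|^{−1−2H} dξ ≤ C a^{(2H−γ)/2} |h|^γ. In particular the integral is bounded both by C|h|^{2H} and by C a^H. -/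
open MeasureTheory Real

/-- For `0 < H < 1`, the function `min 1 ξ² |ξ|^{-1-2H}` is integrable on the line. -/
lemma integrable_min_one_sq_mul_abs_rpow_s17 {H : ℝ} (h0 : 0 < H) (h1 : H < 1) :
    Integrable (fun ξ : ℝ => min 1 (ξ ^ 2) * |ξ| ^ (-1 - 2 * H)) := by
  have key : IntegrableOn (fun y : ℝ => min 1 (y ^ 2) * y ^ (-1 - 2 * H)) (Set.Ioi 0) := by
    rw [← Set.Ioc_union_Ioi_eq_Ioi (zero_le_one (α := ℝ))]
    refine IntegrableOn.union ?_ ?_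
    · have h : IntegrableOn (fun y : ℝ => y ^ (1 - 2 * H)) (Set.Ioc 0 1) :=
        (intervalIntegrable_iff_integrableOn_Ioc_of_le zero_le_one).1
          (intervalIntegral.intervalIntegrable_rpow' (by linarith))
      refine h.congr_fun (fun y hy => ?_) measurableSet_Ioc
      have hy2 : y ^ 2 ≤ 1 := pow_le_one₀ hy.1.le hy.2
      simp only [min_eq_right hy2]
      rw [← rpow_natCast, ← rpow_add hy.1]
      congr 1
      push_cast
      ring
    · refine (integrableOn_Ioi_rpow_of_lt (a := -1 - 2 * H) (by linarith) one_pos).congr_fun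
        (fun y hy => ?_) measurableSet_Ioi
      have hy2 : 1 ≤ y ^ 2 := one_le_pow₀ (le_of_lt hy)
      simp only [min_eq_left hy2, one_mul]
  have h := (integrable_fun_norm_addHaar (volume : Measure ℝ)
    (f := fun y : ℝ => min 1 (y ^ 2) * y ^ (-1 - 2 * H))).2 (by simpa using key)
  simpa using h

/-- Scaling identity for the truncated kernel `min 1 (bξ)² |ξ|^{-1-2H}`. -/
lemma lintegral_min_one_sq_mul_abs_rpow {H : ℝ} (h0 : 0 < H) (h1 : H < 1) {b : ℝ} (hb : 0 < b) :
    ∫⁻ ξ : ℝ, ENNReal.ofReal (min 1 ((b * ξ) ^ 2) * |ξ| ^ (-1 - 2 * H)) =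
      ENNReal.ofReal ((∫ ξ : ℝ, min 1 (ξ ^ 2) * |ξ| ^ (-1 - 2 * H)) * b ^ (2 * H)) := by
  have hscale : (fun ξ : ℝ => min 1 ((b * ξ) ^ 2) * |ξ| ^ (-1 - 2 * H)) = fun ξ =>
      b ^ (1 + 2 * H) * (min 1 ((b * ξ) ^ 2) * |b * ξ| ^ (-1 - 2 * H)) := by
    ext ξ
    rw [abs_mul, abs_of_pos hb, mul_rpow hb.le (abs_nonneg ξ)]
    have : b ^ (1 + 2 * H) * b ^ (-1 - 2 * H) = 1 := by
      rw [← rpow_add hb]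
      ring_nf
      exact rpow_zero b
    linear_combination (-min 1 ((b * ξ) ^ 2) * |ξ| ^ (-1 - 2 * H)) * this
  have hint := ((integrable_min_one_sq_mul_abs_rpow_s17 h0 h1).comp_mul_left' hb.ne').const_mul
    (b ^ (1 + 2 * H))
  rw [← hscale] at hint
  rw [← ofReal_integral_eq_lintegral_ofReal hint (ae_of_all _ fun ξ => by positivity), hscale,
    integral_const_mul,
    Measure.integral_comp_mul_left (fun ξ : ℝ => min 1 (ξ ^ 2) * |ξ| ^ (-1 - 2 * H)) b,
    abs_of_pos (inv_pos.2 hb), rpow_add hb, rpow_one, smul_eq_mul]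
  congr 1
  field_simp

lemma sq_one_sub_exp_neg_le_min {x : ℝ} (hx : 0 ≤ x) :
    (1 - exp (-x / 2)) ^ 2 ≤ min 1 x := by
  have h1 : exp (-x / 2) ≤ 1 := exp_le_one_iff.2 (by linarith)
  have h2 := exp_pos (-x / 2)
  have h3 := add_one_le_exp (-x / 2)
  refine le_min ?_ ?_ <;> nlinarith

lemma sin_sq_le_min (x : ℝ) : sin (x / 2) ^ 2 ≤ min 1 (x ^ 2) :=
  le_min (sin_sq_le_one _) ((sin_sq_le_sq).trans (by nlinarith [sq_nonneg x]))

/-- For `H ∈ (0,1/2)` there is a finite constant `C = C(H)` such that for all `a > 0`,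
`h ∈ ℝ` and `γ ∈ [0, 2H]`,
`∫_ℝ (1 - e^{-a ξ²/2})² sin²(ξ h/2) |ξ|^{-1-2H} dξ ≤ C a^{(2H-γ)/2} |h|^γ`;
in particular (taking `γ = 2H` and `γ = 0`) the integral is bounded by `C |h|^{2H}`
and by `C a^H`. -/
theorem stmt_17 (H : ℝ) (hH : H ∈ Set.Ioo (0:ℝ) (1/2)) :
    ∃ C : ℝ, 0 < C ∧ ∀ a : ℝ, 0 < a → ∀ h : ℝ, ∀ γ : ℝ, γ ∈ Set.Icc (0:ℝ) (2 * H) →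
      (∫⁻ ξ : ℝ, ENNReal.ofReal
          ((1 - Real.exp (-(a * ξ ^ 2) / 2)) ^ 2 * Real.sin (ξ * h / 2) ^ 2 *
            |ξ| ^ (-1 - 2 * H)))
        ≤ ENNReal.ofReal (C * a ^ ((2 * H - γ) / 2) * |h| ^ γ) := by
  obtain ⟨h0, h1⟩ := hH
  have hH1 : H < 1 := by linarith
  set K : ℝ := ∫ ξ : ℝ, min 1 (ξ ^ 2) * |ξ| ^ (-1 - 2 * H)
  have hK0 : 0 ≤ K := integral_nonneg fun ξ => by positivity
  refine ⟨K + 1, by linarith, fun a ha h γ ⟨hγ0, hγ1⟩ => ?_⟩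
  rcases eq_or_ne h 0 with rfl | hh
  · simp
  have hh' : 0 < |h| := abs_pos.2 hh
  have hs : 0 < √a := sqrt_pos.2 ha
  have hpow : a ^ ((2 * H - γ) / 2) = √a ^ (2 * H - γ) := by
    rw [sqrt_eq_rpow, ← rpow_mul ha.le]
    congr 1
    ring
  have hbound : ∀ b : ℝ, 0 < b → b ^ (2 * H) ≤ √a ^ (2 * H - γ) * |h| ^ γ →
      (∀ ξ : ℝ, (1 - exp (-(a * ξ ^ 2) / 2)) ^ 2 * sin (ξ * h / 2) ^ 2 ≤
        min 1 ((b * ξ) ^ 2)) →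
      (∫⁻ ξ : ℝ, ENNReal.ofReal
          ((1 - exp (-(a * ξ ^ 2) / 2)) ^ 2 * sin (ξ * h / 2) ^ 2 * |ξ| ^ (-1 - 2 * H)))
        ≤ ENNReal.ofReal ((K + 1) * a ^ ((2 * H - γ) / 2) * |h| ^ γ) := by
    intro b hb hle hpt
    calc
      _ ≤ ∫⁻ ξ : ℝ, ENNReal.ofReal (min 1 ((b * ξ) ^ 2) * |ξ| ^ (-1 - 2 * H)) :=
        lintegral_mono fun ξ => ENNReal.ofReal_le_ofReal
          (mul_le_mul_of_nonneg_right (hpt ξ) (by positivity))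
      _ = ENNReal.ofReal (K * b ^ (2 * H)) := lintegral_min_one_sq_mul_abs_rpow h0 hH1 hb
      _ ≤ _ := by
        refine ENNReal.ofReal_le_ofReal ?_
        rw [hpow, mul_assoc]
        exact mul_le_mul (by linarith) hle (by positivity) (by linarith)
  have hexp (ξ : ℝ) := sq_one_sub_exp_neg_le_min (x := a * ξ ^ 2) (by positivity)
  rcases le_total (√a) |h| with hle | hle
  · refine hbound (√a) hs ?_ fun ξ => ?_
    · calc √a ^ (2 * H) = √a ^ (2 * H - γ) * √a ^ γ := by rw [← rpow_add hs, sub_add_cancel]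
        _ ≤ _ := by gcongr
    · rw [mul_pow, sq_sqrt ha.le]
      exact (mul_le_of_le_one_right (sq_nonneg _) (sin_sq_le_one _)).trans (hexp ξ)
  · refine hbound |h| hh' ?_ fun ξ => ?_
    · calc |h| ^ (2 * H) = |h| ^ (2 * H - γ) * |h| ^ γ := by rw [← rpow_add hh', sub_add_cancel]
        _ ≤ _ := by gcongr
    · have hsin := sin_sq_le_min (ξ * h)
      rw [mul_pow, sq_abs, mul_comm (h ^ 2), ← mul_pow ξ h]
      exact (mul_le_of_le_one_left (sq_nonneg _) ((hexp ξ).trans (min_le_left _ _))).trans hsin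
end
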